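/- arXiv:2507.14404 — 8 statements merged into one kernel-verified Lean document; each statement's English description precedes it below -/
import Mathlib

section
/- Let T be a closed densely defined operator on H. Then the following are equivalent: (i) T is quasi-affine to some nonnegative selfadjoint operator S, i.e. there exist a nonnegative selfadjoint S and a quasi-affinity G with G∘T ⊆ S∘G; (ii) T ⊆ B∘A with B⁻¹ ∈ L⁺(H) and A nonnegative selfadjoint, i.e. there exist an injective W ∈ L⁺(H) and a nonnegative selfadjoint operator A such that dom T ⊆ dom A and W(Tx) = Ax for all x ∈ dom T; (iii) there exists a quasi-affinity X ∈ L⁺(H) such that for all x ∈ dom T: Xx ∈ dom T*, T*(Xx) = X(Tx), and ⟨X(Tx), x⟩ ≥ 0 (i.e. 0 ≤ X∘T ⊆ T*∘X). -/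
open scoped ComplexOrder
noncomputable section

local notation "⟪" x ", " y "⟫" => @inner ℂ _ _ x y

section Toolkit

/-- Composition of partially defined linear maps:
`pcomp S T` has domain `{x ∈ dom T : T x ∈ dom S}` and maps `x ↦ S (T x)`. -/
def pcomp {R E F G : Type*} [CommRing R] [AddCommGroup E] [Module R E]
    [AddCommGroup F] [Module R F] [AddCommGroup G] [Module R G]
    (S : F →ₗ.[R] G) (T : E →ₗ.[R] F) : E →ₗ.[R] G where
  domain := (S.domain.comap T.toFun).map T.domain.subtype
  toFun := (S.toFun.comp (T.toFun.restrict (p := S.domain.comap T.toFun) (q := S.domain)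
      fun _ hx => hx)).comp
    (Submodule.equivMapOfInjective T.domain.subtype (Submodule.injective_subtype _)
      (S.domain.comap T.toFun)).symm.toLinearMap

/-- A bounded everywhere-defined operator viewed as a `LinearPMap` with domain `⊤`. -/
def ofCLM {E F : Type*} [NormedAddCommGroup E] [NormedAddCommGroup F]
    [NormedSpace ℂ E] [NormedSpace ℂ F] (X : E →L[ℂ] F) : E →ₗ.[ℂ] F :=
  (X : E →ₗ[ℂ] F).toPMap ⊤

variable {H : Type*} [NormedAddCommGroup H] [InnerProductSpace ℂ H] [CompleteSpace H]

/-- `B` is nonnegative selfadjoint: densely defined, `B* = B`, and `⟪Bx, x⟫ ≥ 0` on `dom B`. -/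
def IsNonnegSelfAdjoint (B : H →ₗ.[ℂ] H) : Prop :=
  Dense (B.domain : Set H) ∧ B.adjoint = B ∧ ∀ x : B.domain, 0 ≤ ⟪B x, (x : H)⟫

/-- `C` is a selfadjoint partial operator: densely defined with `C* = C`. -/
def IsSelfAdjointPMap (C : H →ₗ.[ℂ] H) : Prop :=
  Dense (C.domain : Set H) ∧ C.adjoint = C

/-- A quasi-affinity: an injective bounded everywhere-defined operator with dense range. -/
def IsQuasiAffinity (G : H →L[ℂ] H) : Prop :=
  Function.Injective G ∧ DenseRange G

end Toolkit

section Friedrichs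

open UniformSpace ContinuousLinearMap

variable {H : Type*} [NormedAddCommGroup H] [InnerProductSpace ℂ H]

/-- A map `A` which is nonnegative symmetric relative to an injective map `f` with dense range
gives the inner product `⟪A x, f y⟫ + ⟪f x, f y⟫` on the common domain. -/
@[reducible]
def formCore {D : Type*} [AddCommGroup D] [Module ℂ D] (f A : D →ₗ[ℂ] H)
    (hf : Function.Injective f) (hsymm : ∀ x y, ⟪A x, f y⟫ = ⟪f x, A y⟫)
    (hnonneg : ∀ x, 0 ≤ ⟪A x, f x⟫) : InnerProductSpace.Core ℂ D where
  inner x y := ⟪A x, f y⟫ + ⟪f x, f y⟫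
  conj_inner_symm x y := by simp [hsymm]
  re_inner_nonneg x := by
    have h := (Complex.le_def.1 (hnonneg x)).1
    have h' : 0 ≤ RCLike.re ⟪f x, f x⟫ := inner_self_nonneg
    simp only [map_add]
    exact add_nonneg h h'
  add_left x y z := by simp only [map_add, inner_add_left]; ring
  smul_left x y r := by simp only [map_smul, inner_smul_left]; ring
  definite x hx := by
    have h := (Complex.le_def.1 (hnonneg x)).1
    have h' : 0 ≤ RCLike.re ⟪f x, f x⟫ := inner_self_nonneg
    have h0 := congrArg Complex.re hx
    simp only [Complex.add_re, Complex.zero_re] at h h0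
    have h1 : RCLike.re ⟪f x, f x⟫ = 0 := le_antisymm (by change Complex.re _ ≤ 0; linarith) h'
    have h2 : ‖f x‖ ^ 2 = 0 := (norm_sq_eq_re_inner (𝕜 := ℂ) (f x)).trans h1
    exact hf (by simpa using h2)

variable [CompleteSpace H]

/-- The inverse of the Friedrichs extension of `1 + A`, when the inner product of `D` is the form
of `1 + A`. -/
lemma exists_resolvent_of_form {D : Type*} [NormedAddCommGroup D] [InnerProductSpace ℂ D]
    (f A : D →ₗ[ℂ] H) (hd : DenseRange f) (hle : ∀ x, ‖f x‖ ≤ ‖x‖)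
    (hform : ∀ x y, ⟪A x + f x, f y⟫ = ⟪x, y⟫) :
    ∃ R : H →L[ℂ] H, R.IsPositive ∧ Function.Injective R ∧
      (∀ u, ‖R u‖ ^ 2 ≤ RCLike.re ⟪R u, u⟫) ∧ ∀ x, R (A x + f x) = f x := by
  let e : D →ₗ[ℂ] Completion D := (Completion.toComplL : D →L[ℂ] Completion D).toLinearMap
  have he : DenseRange e := Completion.denseRange_coe
  have hle' : ∀ x, ‖f x‖ ≤ 1 * ‖e x‖ := fun x => by
    simpa [e] using hle x
  let J : Completion D →L[ℂ] H := f.extendOfNorm e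
  have hJ : ∀ x : D, J (x : Completion D) = f x := fun x =>
    f.extendOfNorm_eq he ⟨1, hle'⟩ x
  have hJle : ∀ v, ‖J v‖ ≤ ‖v‖ := fun v => by
    simpa using f.norm_extendOfNorm_apply_le he 1 hle' v
  have hadj : ∀ x, J.adjoint (A x + f x) = (x : Completion D) := fun x => by
    refine ext_inner_right ℂ fun v => ?_
    induction v using Completion.induction_on with
    | hp => exact isClosed_eq (by fun_prop) (by fun_prop)
    | ih y => rw [adjoint_inner_left, hJ, hform, Completion.inner_coe]
  have hinj : ∀ u, J.adjoint u = 0 → u = 0 := fun u hu => by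
    refine hd.eq_zero_of_inner_left ℂ ?_
    intro y
    rw [← hJ, ← adjoint_inner_left, hu, inner_zero_left]
  have hre : ∀ u, RCLike.re ⟪J (J.adjoint u), u⟫ = ‖J.adjoint u‖ ^ 2 := fun u => by
    rw [← adjoint_inner_right, ← norm_sq_eq_re_inner]
  refine ⟨J ∘L J.adjoint, isPositive_self_comp_adjoint J, ?_, fun u => ?_, fun x => ?_⟩
  · refine (injective_iff_map_eq_zero _).2 fun u hu => hinj u ?_
    have h := hre u
    rw [show J (J.adjoint u) = 0 from hu] at h
    simpa using h.symm
  · rw [comp_apply, hre]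
    gcongr
    exact hJle _
  · rw [comp_apply, hadj, hJ]

lemma denseRange_of_isPositive {R : H →L[ℂ] H} (hR : R.IsPositive)
    (hinj : Function.Injective R) : DenseRange R := by
  have h : R.rangeᗮ = ⊥ := by
    rw [R.orthogonal_range, hR.isSelfAdjoint.adjoint_eq]
    exact LinearMap.ker_eq_bot.2 hinj
  have h' := Submodule.dense_iff_topologicalClosure_eq_top.2
    ((Submodule.topologicalClosure_eq_top_iff).2 h)
  exact h'

/-- The operator `R⁻¹ - 1` is nonnegative selfadjoint when `R` is injective and `0 ≤ R² ≤ R`. -/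
lemma exists_isNonnegSelfAdjoint_of_resolvent {R : H →L[ℂ] H} (hR : R.IsPositive)
    (hinj : Function.Injective R) (hle : ∀ u, ‖R u‖ ^ 2 ≤ RCLike.re ⟪R u, u⟫) :
    ∃ S : H →ₗ.[ℂ] H, IsNonnegSelfAdjoint S ∧
      ∀ u, ∃ h : R u ∈ S.domain, S ⟨R u, h⟩ = u - R u := by
  let i := LinearEquiv.ofInjective R.toLinearMap hinj
  let S : H →ₗ.[ℂ] H := ⟨R.range, i.symm.toLinearMap - Submodule.subtype _⟩
  have hS : ∀ u, ∃ h : R u ∈ S.domain, S ⟨R u, h⟩ = u - R u := fun u =>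
    ⟨⟨u, rfl⟩, congrArg (· - R u) (i.symm_apply_apply u)⟩
  have hsymm := hR.inner_left_eq_inner_right
  have hdense : Dense (S.domain : Set H) := denseRange_of_isPositive hR hinj
  have hformal : S.IsFormalAdjoint S := by
    rintro ⟨_, u, rfl⟩ ⟨_, v, rfl⟩
    change ⟪S ⟨R u, _⟩, R v⟫ = ⟪R u, S ⟨R v, _⟩⟫
    rw [(hS u).2, (hS v).2, inner_sub_left, inner_sub_right, ← hsymm]
  refine ⟨S, ⟨hdense, ?_, ?_⟩, hS⟩
  · have hdom : S.adjoint.domain ≤ S.domain := fun y hy => by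
      have hy' := S.adjoint_isFormalAdjoint hdense ⟨y, hy⟩
      refine ⟨S.adjoint ⟨y, hy⟩ + y, ext_inner_right ℂ fun u => ?_⟩
      have h := hy' ⟨R u, (hS u).1⟩
      rw [(hS u).2, inner_sub_right] at h
      change ⟪R _, u⟫ = _
      rw [hsymm, inner_add_left]
      exact eq_sub_iff_add_eq.1 h
    have hSle := hformal.le_adjoint hdense
    exact (LinearPMap.eq_of_le_of_domain_eq hSle (le_antisymm hSle.1 hdom)).symm
  · rintro ⟨_, u, rfl⟩
    change 0 ≤ ⟪S ⟨R u, _⟩, R u⟫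
    rw [(hS u).2, inner_sub_left, ← hsymm, Complex.le_def]
    have h := hle u
    rw [norm_sq_eq_re_inner (𝕜 := ℂ)] at h
    have him : (⟪R u, R u⟫).im = 0 := inner_self_im (𝕜 := ℂ) (R u)
    exact ⟨sub_nonneg.2 h, by
      rw [Complex.sub_im, him, sub_zero]
      exact (Complex.le_def.1 (hR.inner_nonneg_left u)).2⟩

/-- **Friedrichs extension** of the operator `f x ↦ A x`. -/
theorem exists_isNonnegSelfAdjoint_extension {D : Type*} [AddCommGroup D] [Module ℂ D]
    (f A : D →ₗ[ℂ] H) (hf : Function.Injective f) (hd : DenseRange f)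
    (hsymm : ∀ x y, ⟪A x, f y⟫ = ⟪f x, A y⟫) (hnonneg : ∀ x, 0 ≤ ⟪A x, f x⟫) :
    ∃ S : H →ₗ.[ℂ] H, IsNonnegSelfAdjoint S ∧
      ∀ x, ∃ h : f x ∈ S.domain, S ⟨f x, h⟩ = A x := by
  let c := formCore f A hf hsymm hnonneg
  let : NormedAddCommGroup D := c.toNormedAddCommGroup
  let : InnerProductSpace ℂ D := InnerProductSpace.ofCore c.toCore
  have hform : ∀ x y : D, ⟪A x + f x, f y⟫ = ⟪x, y⟫ := fun x y => inner_add_left _ _ _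
  have hle : ∀ x : D, ‖f x‖ ≤ ‖x‖ := fun x => by
    refine le_of_sq_le_sq ?_ (norm_nonneg _)
    rw [norm_sq_eq_re_inner (𝕜 := ℂ), norm_sq_eq_re_inner (𝕜 := ℂ) x, ← hform, inner_add_left,
      map_add]
    exact le_add_of_nonneg_left (Complex.le_def.1 (hnonneg x)).1
  obtain ⟨R, hR, hinj, hRle, hRf⟩ := exists_resolvent_of_form f A hd hle hform
  obtain ⟨S, hS, hSR⟩ := exists_isNonnegSelfAdjoint_of_resolvent hR hinj hRle
  refine ⟨S, hS, fun x => ?_⟩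
  simpa [hRf] using hSR (A x + f x)

end Friedrichs

section QuasiAffine

open ContinuousLinearMap

variable {H : Type*} [NormedAddCommGroup H] [InnerProductSpace ℂ H] [CompleteSpace H]

lemma IsNonnegSelfAdjoint.isFormalAdjoint {S : H →ₗ.[ℂ] H} (hS : IsNonnegSelfAdjoint S) :
    S.IsFormalAdjoint S := by
  simpa only [hS.2.1] using S.adjoint_isFormalAdjoint hS.1

lemma exists_adjoint_apply_eq {T : H →ₗ.[ℂ] H} (hTd : Dense (T.domain : Set H)) {y w : H}
    (h : ∀ x : T.domain, ⟪w, (x : H)⟫ = ⟪y, T x⟫) :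
    ∃ hy : y ∈ T.adjoint.domain, T.adjoint ⟨y, hy⟩ = w :=
  ⟨T.mem_adjoint_domain_of_exists y ⟨w, h⟩, T.adjoint_apply_eq hTd _ h⟩

/-- If `G T ⊆ S G` with `S` nonnegative selfadjoint, then `X = G* G` satisfies `0 ≤ X T ⊆ T* X`. -/
lemma exists_symmetrizer_of_quasiAffine {T S : H →ₗ.[ℂ] H} {G : H →L[ℂ] H}
    (hTd : Dense (T.domain : Set H)) (hS : IsNonnegSelfAdjoint S) (hG : Function.Injective G)
    (hGT : ∀ x : T.domain, ∃ h : G (x : H) ∈ S.domain, S ⟨G (x : H), h⟩ = G (T x)) :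
    ∃ X : H →L[ℂ] H, X.IsPositive ∧ IsQuasiAffinity X ∧
      ∀ x : T.domain, ∃ h : X (x : H) ∈ T.adjoint.domain,
        T.adjoint ⟨X (x : H), h⟩ = X (T x) ∧ 0 ≤ ⟪X (T x), (x : H)⟫ := by
  have hX : (G.adjoint ∘L G).IsPositive := isPositive_adjoint_comp_self G
  have hinj : Function.Injective (G.adjoint ∘L G) := by
    refine (injective_iff_map_eq_zero _).2 fun u hu => ?_
    have h : ⟪G u, G u⟫ = 0 := by
      rw [← adjoint_inner_left, show G.adjoint (G u) = 0 from hu, inner_zero_left]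
    exact (injective_iff_map_eq_zero G).1 hG u (inner_self_eq_zero.1 h)
  refine ⟨_, hX, ⟨hinj, denseRange_of_isPositive hX hinj⟩, fun x => ?_⟩
  obtain ⟨hx, hSx⟩ := hGT x
  obtain ⟨h, h'⟩ := exists_adjoint_apply_eq hTd (y := (G.adjoint ∘L G) x)
    (w := (G.adjoint ∘L G) (T x)) fun z => by
      obtain ⟨hz, hSz⟩ := hGT z
      simp only [comp_apply, adjoint_inner_left, ← hSx, ← hSz]
      exact hS.isFormalAdjoint ⟨G x, hx⟩ ⟨G z, hz⟩
  refine ⟨h, h', ?_⟩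
  rw [comp_apply, adjoint_inner_left, ← hSx]
  exact hS.2.2 ⟨G x, hx⟩

lemma inner_symmetrizer {T : H →ₗ.[ℂ] H} {X : H →L[ℂ] H} (hTd : Dense (T.domain : Set H))
    (hX : X.IsPositive)
    (hXT : ∀ x : T.domain, ∃ h : X (x : H) ∈ T.adjoint.domain,
      T.adjoint ⟨X (x : H), h⟩ = X (T x) ∧ 0 ≤ ⟪X (T x), (x : H)⟫) (x y : T.domain) :
    ⟪X (T x), (y : H)⟫ = ⟪(x : H), X (T y)⟫ := by
  obtain ⟨h, h', -⟩ := hXT x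
  rw [← h', T.adjoint_isFormalAdjoint hTd ⟨X x, h⟩ y]
  exact hX.inner_left_eq_inner_right _ _

lemma exists_sqrt_of_isPositive {X : H →L[ℂ] H} (hX : X.IsPositive) :
    ∃ G : H →L[ℂ] H, G.IsPositive ∧ ∀ u, G (G u) = X u := by
  have h0 : 0 ≤ X := (nonneg_iff_isPositive X).2 hX
  exact ⟨CFC.sqrt X, (nonneg_iff_isPositive _).1 (CFC.sqrt_nonneg X), fun u =>
    congrArg (fun Y : H →L[ℂ] H => Y u) (CFC.sqrt_mul_sqrt_self X h0)⟩

lemma exists_quasiAffine_of_symmetrizer {T : H →ₗ.[ℂ] H} {X : H →L[ℂ] H}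
    (hTd : Dense (T.domain : Set H)) (hX : X.IsPositive) (hinj : Function.Injective X)
    (hXT : ∀ x : T.domain, ∃ h : X (x : H) ∈ T.adjoint.domain,
      T.adjoint ⟨X (x : H), h⟩ = X (T x) ∧ 0 ≤ ⟪X (T x), (x : H)⟫) :
    ∃ (S : H →ₗ.[ℂ] H) (G : H →L[ℂ] H), IsNonnegSelfAdjoint S ∧ IsQuasiAffinity G ∧
      ∀ x : T.domain, ∃ h : G (x : H) ∈ S.domain, S ⟨G (x : H), h⟩ = G (T x) := by
  obtain ⟨G, hG, hGX⟩ := exists_sqrt_of_isPositive hX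
  have hGinj : Function.Injective G := fun u v huv => hinj (by rw [← hGX, ← hGX, huv])
  have hGd := denseRange_of_isPositive hG hGinj
  have hGsymm := hG.inner_left_eq_inner_right
  obtain ⟨S, hS, hST⟩ := exists_isNonnegSelfAdjoint_extension
    (G.toLinearMap ∘ₗ T.domain.subtype) (G.toLinearMap ∘ₗ T.toFun)
    (hGinj.comp Subtype.val_injective)
    (hGd.comp hTd.denseRange_val G.continuous)
    (fun x y => by
      change ⟪G (T x), G y⟫ = ⟪G x, G (T y)⟫
      rw [← hGsymm, hGX, hGsymm, hGX, inner_symmetrizer hTd hX hXT])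
    (fun x => by
      change 0 ≤ ⟪G (T x), G x⟫
      rw [← hGsymm, hGX]
      exact (hXT x).2.2)
  exact ⟨S, G, hS, ⟨hGinj, hGd⟩, hST⟩

lemma exists_extension_of_symmetrizer {T : H →ₗ.[ℂ] H} {X : H →L[ℂ] H}
    (hTd : Dense (T.domain : Set H)) (hX : X.IsPositive)
    (hXT : ∀ x : T.domain, ∃ h : X (x : H) ∈ T.adjoint.domain,
      T.adjoint ⟨X (x : H), h⟩ = X (T x) ∧ 0 ≤ ⟪X (T x), (x : H)⟫) :
    ∃ A : H →ₗ.[ℂ] H, IsNonnegSelfAdjoint A ∧ ∃ h : T.domain ≤ A.domain,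
      ∀ x : T.domain, X (T x) = A ⟨(x : H), h x.2⟩ := by
  obtain ⟨A, hA, hAT⟩ := exists_isNonnegSelfAdjoint_extension T.domain.subtype
    (X.toLinearMap ∘ₗ T.toFun) Subtype.val_injective hTd.denseRange_val
    (inner_symmetrizer hTd hX hXT) (fun x => (hXT x).2.2)
  exact ⟨A, hA, fun x hx => (hAT ⟨x, hx⟩).1, fun x => (hAT x).2.symm⟩

lemma symmetrizer_of_le_nonnegSelfAdjoint {T A : H →ₗ.[ℂ] H} {W : H →L[ℂ] H}
    (hTd : Dense (T.domain : Set H)) (hW : W.IsPositive) (hA : IsNonnegSelfAdjoint A)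
    (hle : T.domain ≤ A.domain) (hWT : ∀ x : T.domain, W (T x) = A ⟨(x : H), hle x.2⟩)
    (x : T.domain) : ∃ h : W (x : H) ∈ T.adjoint.domain,
      T.adjoint ⟨W (x : H), h⟩ = W (T x) ∧ 0 ≤ ⟪W (T x), (x : H)⟫ := by
  obtain ⟨h, h'⟩ := exists_adjoint_apply_eq hTd (y := W x) (w := W (T x)) fun z => by
    rw [hW.inner_left_eq_inner_right x, hWT, hWT]
    exact hA.isFormalAdjoint ⟨x, hle x.2⟩ ⟨z, hle z.2⟩
  refine ⟨h, h', ?_⟩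
  rw [hWT]
  exact hA.2.2 ⟨x, hle x.2⟩

end QuasiAffine

/-- for a closed densely defined `T` on `H` the following are equivalent:
(i) `T` is quasi-affine to some nonnegative selfadjoint `S`;
(ii) `T ⊆ B ∘ A` with `B⁻¹ = W ∈ L⁺(H)` injective and `A` nonnegative selfadjoint;
(iii) there is a positive quasi-affinity `X` with `0 ≤ X ∘ T ⊆ T* ∘ X`. -/
theorem statement11
    {H : Type*} [NormedAddCommGroup H] [InnerProductSpace ℂ H] [CompleteSpace H]
    (T : H →ₗ.[ℂ] H) (hT : T.IsClosed) (hTd : Dense (T.domain : Set H)) :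
    ((∃ (S : H →ₗ.[ℂ] H) (G : H →L[ℂ] H), IsNonnegSelfAdjoint S ∧ IsQuasiAffinity G ∧
        ∀ x : T.domain, ∃ h : G (x : H) ∈ S.domain, S ⟨G (x : H), h⟩ = G (T x)) ↔
      (∃ (W : H →L[ℂ] H) (A : H →ₗ.[ℂ] H), W.IsPositive ∧ Function.Injective W ∧
        IsNonnegSelfAdjoint A ∧ ∃ h : T.domain ≤ A.domain,
          ∀ x : T.domain, W (T x) = A ⟨(x : H), h x.2⟩)) ∧
    ((∃ (W : H →L[ℂ] H) (A : H →ₗ.[ℂ] H), W.IsPositive ∧ Function.Injective W ∧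
        IsNonnegSelfAdjoint A ∧ ∃ h : T.domain ≤ A.domain,
          ∀ x : T.domain, W (T x) = A ⟨(x : H), h x.2⟩) ↔
      (∃ X : H →L[ℂ] H, X.IsPositive ∧ IsQuasiAffinity X ∧
        ∀ x : T.domain, ∃ h : X (x : H) ∈ T.adjoint.domain,
          T.adjoint ⟨X (x : H), h⟩ = X (T x) ∧ 0 ≤ ⟪X (T x), (x : H)⟫)) := by
  constructor
  · constructor
    · rintro ⟨S, G, hS, hG, hGT⟩
      obtain ⟨X, hX, hXq, hXT⟩ := exists_symmetrizer_of_quasiAffine hTd hS hG.1 hGT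
      obtain ⟨A, hA, h⟩ := exists_extension_of_symmetrizer hTd hX hXT
      exact ⟨X, A, hX, hXq.1, hA, h⟩
    · rintro ⟨W, A, hW, hinj, hA, hle, hWT⟩
      exact exists_quasiAffine_of_symmetrizer hTd hW hinj
        (symmetrizer_of_le_nonnegSelfAdjoint hTd hW hA hle hWT)
  · constructor
    · rintro ⟨W, A, hW, hinj, hA, hle, hWT⟩
      exact ⟨W, hW, ⟨hinj, denseRange_of_isPositive hW hinj⟩,
        symmetrizer_of_le_nonnegSelfAdjoint hTd hW hA hle hWT⟩
    · rintro ⟨X, hX, hXq, hXT⟩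
      obtain ⟨A, hA, h⟩ := exists_extension_of_symmetrizer hTd hX hXT
      exact ⟨X, A, hX, hXq.1, hA, h⟩
end
end

section
/- Let T be a closed densely defined operator on H. Then the following are equivalent: (i) T = B∘A with B⁻¹ ∈ L⁺(H), A nonnegative selfadjoint and dom T = dom A, i.e. there exist an injective W ∈ L⁺(H) and a nonnegative selfadjoint operator A such that dom T = dom A and W(Tx) = Ax for all x ∈ dom T; (ii) there exists a quasi-affinity X ∈ L⁺(H) such that X∘T = T*∘X ≥ 0 as an equality of partial operators, i.e. {y ∈ H : Xy ∈ dom T*} = dom T, X(Tx) = T*(Xx) for all x ∈ dom T, and ⟨X(Tx), x⟩ ≥ 0 for all x ∈ dom T. -/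
open scoped ComplexOrder
noncomputable section

local notation "⟪" x ", " y "⟫" => @inner ℂ _ _ x y

section PositiveComposition

variable {H : Type*} [NormedAddCommGroup H] [InnerProductSpace ℂ H] [CompleteSpace H]

theorem IsSelfAdjoint.isQuasiAffinity_of_injective {W : H →L[ℂ] H} (hW : IsSelfAdjoint W)
    (hinj : Function.Injective W) : IsQuasiAffinity W := by
  refine ⟨hinj, ?_⟩
  have h : (W.range)ᗮ = ⊥ := by
    rw [ContinuousLinearMap.orthogonal_range, hW.adjoint_eq]
    exact LinearMap.ker_eq_bot.mpr hinj
  exact Submodule.dense_iff_topologicalClosure_eq_top.mpr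
    (Submodule.topologicalClosure_eq_top_iff.mpr h)

theorem IsSelfAdjoint.mem_adjoint_compPMap_domain_iff {W : H →L[ℂ] H} (hW : IsSelfAdjoint W)
    (T : H →ₗ.[ℂ] H) (y : H) :
    y ∈ ((W : H →ₗ[ℂ] H).compPMap T).adjoint.domain ↔ W y ∈ T.adjoint.domain := by
  rw [LinearPMap.mem_adjoint_domain_iff, LinearPMap.mem_adjoint_domain_iff]
  refine iff_of_eq (congrArg _ (funext fun x => ?_))
  exact (hW.isSymmetric y (T x)).symm

theorem IsSelfAdjoint.adjoint_compPMap_apply {W : H →L[ℂ] H} (hW : IsSelfAdjoint W)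
    {T : H →ₗ.[ℂ] H} (hT : Dense (T.domain : Set H))
    (y : ((W : H →ₗ[ℂ] H).compPMap T).adjoint.domain) :
    ((W : H →ₗ[ℂ] H).compPMap T).adjoint y =
      T.adjoint ⟨W y, (hW.mem_adjoint_compPMap_domain_iff T y).mp y.2⟩ := by
  refine LinearPMap.adjoint_apply_eq (T := (W : H →ₗ[ℂ] H).compPMap T) hT y fun x => ?_
  exact (LinearPMap.adjoint_isFormalAdjoint hT _ x).trans (hW.isSymmetric y (T x))

end PositiveComposition

/-- for a closed densely defined `T` on `H` the following are equivalent: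
(i) `T = B ∘ A` with `B⁻¹ = W ∈ L⁺(H)` injective, `A` nonnegative selfadjoint, `dom T = dom A`;
(ii) there is a positive quasi-affinity `X` with `X ∘ T = T* ∘ X ≥ 0` as partial operators. -/
theorem statement12
    {H : Type*} [NormedAddCommGroup H] [InnerProductSpace ℂ H] [CompleteSpace H]
    (T : H →ₗ.[ℂ] H) (hT : T.IsClosed) (hTd : Dense (T.domain : Set H)) :
    (∃ (W : H →L[ℂ] H) (A : H →ₗ.[ℂ] H), W.IsPositive ∧ Function.Injective W ∧
        IsNonnegSelfAdjoint A ∧ ∃ h : T.domain = A.domain,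
          ∀ x : T.domain, W (T x) = A ⟨(x : H), h ▸ x.2⟩) ↔
    (∃ X : H →L[ℂ] H, X.IsPositive ∧ IsQuasiAffinity X ∧
      ∃ hiff : ∀ y : H, (X y ∈ T.adjoint.domain ↔ y ∈ T.domain),
        ∀ x : T.domain,
          X (T x) = T.adjoint ⟨X (x : H), (hiff (x : H)).mpr x.2⟩ ∧
          0 ≤ ⟪X (T x), (x : H)⟫) := by
  constructor
  · rintro ⟨W, A, hW, hinj, ⟨-, hA, hpos⟩, hdom, hval⟩
    have hWs := hW.isSelfAdjoint
    have hcomp : (W : H →ₗ[ℂ] H).compPMap T = A :=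
      LinearPMap.ext hdom fun x hx hx' => hval ⟨x, hx⟩
    subst hcomp
    have hiff (y : H) : W y ∈ T.adjoint.domain ↔ y ∈ T.domain := by
      rw [← hWs.mem_adjoint_compPMap_domain_iff T y, hA]
      rfl
    refine ⟨W, hW, hWs.isQuasiAffinity_of_injective hinj, hiff, fun x => ⟨?_, hpos x⟩⟩
    rw [← hWs.adjoint_compPMap_apply hTd
      ⟨x, (hWs.mem_adjoint_compPMap_domain_iff T x).mpr ((hiff x).mpr x.2)⟩]
    exact ((LinearPMap.ext_iff.mp hA).2 (hg := x.2)).symm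
  · rintro ⟨X, hX, hXq, hiff, hval⟩
    have hXs := hX.isSelfAdjoint
    refine ⟨X, (X : H →ₗ[ℂ] H).compPMap T, hX, hXq.1, ⟨hTd, ?_, fun x => (hval x).2⟩, rfl,
      fun _ => rfl⟩
    refine LinearPMap.ext (Submodule.ext fun y =>
      (hXs.mem_adjoint_compPMap_domain_iff T y).trans (hiff y)) fun y hy hy' => ?_
    exact (hXs.adjoint_compPMap_apply hTd ⟨y, hy⟩).trans (hval ⟨y, hy'⟩).1.symm
end
end

section
/- Let T be a closed densely defined operator on H and let S be a selfadjoint operator on H. Then T is quasi-similar to S if and only if both T and T* are quasi-affine to S; that is, [there exist quasi-affinities G₁, G₂ with G₁∘T ⊆ S∘G₁ and G₂∘S ⊆ T∘G₂] if and only if [there exist quasi-affinities G, G' with G∘T ⊆ S∘G and G'∘T* ⊆ S∘G']. -/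
open scoped ComplexOrder
noncomputable section

local notation "⟪" x ", " y "⟫" => @inner ℂ _ _ x y

open ContinuousLinearMap in
/-- The adjoint of a quasi-affinity is a quasi-affinity. -/
theorem IsQuasiAffinity.adjoint {H : Type*} [NormedAddCommGroup H] [InnerProductSpace ℂ H]
    [CompleteSpace H] {G : H →L[ℂ] H} (hG : IsQuasiAffinity G) :
    IsQuasiAffinity (ContinuousLinearMap.adjoint G) := by
  constructor
  · refine (injective_iff_map_eq_zero _).2 fun x hx => ?_
    refine hG.2.eq_zero_of_inner_left ℂ ?_
    intro y
    rw [← adjoint_inner_left, hx, inner_zero_left]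
  · have h : (LinearMap.range (ContinuousLinearMap.adjoint G).toLinearMap)ᗮ = ⊥ := by
      rw [Submodule.eq_bot_iff]
      intro x hx
      refine (injective_iff_map_eq_zero G).1 hG.1 x ?_
      rw [← inner_self_eq_zero (𝕜 := ℂ), ← adjoint_inner_left]
      exact hx _ ⟨G x, rfl⟩
    have hd := (Submodule.dense_iff_topologicalClosure_eq_top).2
      ((Submodule.topologicalClosure_eq_top_iff).2 h)
    exact hd

/-- If `u` and `v` satisfy the defining relation of the double adjoint of a closed densely
defined `T`, then `(u, v)` belongs to the graph of `T`. -/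
theorem LinearPMap.IsClosed.mem_graph_of_forall_inner {𝕜 E F : Type*} [RCLike 𝕜]
    [NormedAddCommGroup E] [InnerProductSpace 𝕜 E] [CompleteSpace E]
    [NormedAddCommGroup F] [InnerProductSpace 𝕜 F] [CompleteSpace F]
    {T : E →ₗ.[𝕜] F} (hT : T.IsClosed) (hTd : Dense (T.domain : Set E)) {u : E} {v : F}
    (h : ∀ y : T.adjoint.domain, inner 𝕜 (T.adjoint y) u = inner 𝕜 (y : F) v) :
    (u, v) ∈ T.graph := by
  let K : Submodule 𝕜 (WithLp 2 (E × F)) :=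
    T.graph.comap (WithLp.linearEquiv 2 𝕜 (E × F)).toLinearMap
  have hK : _root_.IsClosed (K : Set (WithLp 2 (E × F))) :=
    _root_.IsClosed.preimage (WithLp.prod_continuous_ofLp 2 E F) hT
  have : CompleteSpace K := hK.completeSpace_coe
  suffices WithLp.toLp 2 (u, v) ∈ K from this
  rw [← K.orthogonal_orthogonal]
  intro w hw
  have hw' : ∀ x : T.domain, inner 𝕜 (-w.fst) (x : E) = inner 𝕜 w.snd (T x) := fun x => by
    have hx := K.inner_left_of_mem_orthogonal
      (show WithLp.toLp 2 ((x : E), T x) ∈ K from T.mem_graph x) hw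
    rw [WithLp.prod_inner_apply] at hx
    rw [inner_neg_left]
    exact neg_eq_of_add_eq_zero_right hx
  have hmem : w.snd ∈ T.adjoint.domain := LinearPMap.mem_adjoint_domain_of_exists _ ⟨_, hw'⟩
  have hval := h ⟨w.snd, hmem⟩
  rw [LinearPMap.adjoint_apply_eq hTd ⟨w.snd, hmem⟩ hw', inner_neg_left] at hval
  rw [WithLp.prod_inner_apply]
  exact neg_eq_iff_add_eq_zero.1 hval

open ContinuousLinearMap in
/-- Taking adjoints in `G ∘ S ⊆ T ∘ G` gives `G* ∘ T* ⊆ S* ∘ G*`. -/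
theorem LinearPMap.adjoint_intertwines {𝕜 E F : Type*} [RCLike 𝕜]
    [NormedAddCommGroup E] [InnerProductSpace 𝕜 E] [CompleteSpace E]
    [NormedAddCommGroup F] [InnerProductSpace 𝕜 F] [CompleteSpace F]
    {S : E →ₗ.[𝕜] E} {T : F →ₗ.[𝕜] F} (hS : Dense (S.domain : Set E))
    (hT : Dense (T.domain : Set F)) {G : E →L[𝕜] F}
    (hG : ∀ x : S.domain, ∃ h : G (x : E) ∈ T.domain, T ⟨G (x : E), h⟩ = G (S x))
    (y : T.adjoint.domain) :
    ∃ h : ContinuousLinearMap.adjoint G (y : F) ∈ S.adjoint.domain,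
      S.adjoint ⟨ContinuousLinearMap.adjoint G (y : F), h⟩ =
        ContinuousLinearMap.adjoint G (T.adjoint y) := by
  have key : ∀ x : S.domain, inner 𝕜 (ContinuousLinearMap.adjoint G (T.adjoint y)) (x : E) =
      inner 𝕜 (ContinuousLinearMap.adjoint G (y : F)) (S x) := fun x => by
    obtain ⟨h, hx⟩ := hG x
    rw [adjoint_inner_left, adjoint_inner_left, ← hx]
    exact LinearPMap.adjoint_isFormalAdjoint hT y ⟨_, h⟩
  have hmem := LinearPMap.mem_adjoint_domain_of_exists _ ⟨_, key⟩
  exact ⟨hmem, LinearPMap.adjoint_apply_eq hS ⟨_, hmem⟩ key⟩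

/-- a closed densely defined `T` is quasi-similar to a selfadjoint `S` iff both
`T` and `T*` are quasi-affine to `S`. -/
theorem statement14
    {H : Type*} [NormedAddCommGroup H] [InnerProductSpace ℂ H] [CompleteSpace H]
    (T S : H →ₗ.[ℂ] H) (hT : T.IsClosed) (hTd : Dense (T.domain : Set H))
    (hS : IsSelfAdjointPMap S) :
    (∃ G₁ G₂ : H →L[ℂ] H, IsQuasiAffinity G₁ ∧ IsQuasiAffinity G₂ ∧
      (∀ x : T.domain, ∃ h : G₁ (x : H) ∈ S.domain, S ⟨G₁ (x : H), h⟩ = G₁ (T x)) ∧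
      (∀ x : S.domain, ∃ h : G₂ (x : H) ∈ T.domain, T ⟨G₂ (x : H), h⟩ = G₂ (S x))) ↔
    ((∃ G : H →L[ℂ] H, IsQuasiAffinity G ∧
        ∀ x : T.domain, ∃ h : G (x : H) ∈ S.domain, S ⟨G (x : H), h⟩ = G (T x)) ∧
     (∃ G' : H →L[ℂ] H, IsQuasiAffinity G' ∧
        ∀ y : T.adjoint.domain, ∃ h : G' (y : H) ∈ S.domain,
          S ⟨G' (y : H), h⟩ = G' (T.adjoint y))) := by
  obtain ⟨hSd, hSa⟩ := hS
  constructor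
  · rintro ⟨G₁, G₂, hG₁, hG₂, h₁, h₂⟩
    refine ⟨⟨G₁, hG₁, h₁⟩, ContinuousLinearMap.adjoint G₂, hG₂.adjoint, ?_⟩
    have h := LinearPMap.adjoint_intertwines hSd hTd h₂
    rwa [hSa] at h
  · rintro ⟨⟨G, hG, h₁⟩, G', hG', h₂⟩
    refine ⟨G, ContinuousLinearMap.adjoint G', hG, hG'.adjoint, h₁, fun x => ?_⟩
    have hS' : S.IsFormalAdjoint S := by
      simpa only [hSa] using LinearPMap.adjoint_isFormalAdjoint hSd
    have hgraph : (ContinuousLinearMap.adjoint G' (x : H),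
        ContinuousLinearMap.adjoint G' (S x)) ∈ T.graph := by
      refine hT.mem_graph_of_forall_inner hTd fun y => ?_
      obtain ⟨h, hy⟩ := h₂ y
      rw [ContinuousLinearMap.adjoint_inner_right, ContinuousLinearMap.adjoint_inner_right, ← hy]
      exact hS' ⟨_, h⟩ x
    obtain ⟨z, hz, hTz⟩ := (LinearPMap.mem_graph_iff T).1 hgraph
    have hmem : ContinuousLinearMap.adjoint G' (x : H) ∈ T.domain := by
      rw [← show (z : H) = ContinuousLinearMap.adjoint G' (x : H) from hz]
      exact z.2
    exact ⟨hmem, (congrArg T (Subtype.ext hz.symm)).trans hTz⟩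
end
end

section
/- Let T be a closed densely defined operator on H. Then the following are equivalent: (i) T is W-similar to a nonnegative selfadjoint operator (there exist a nonnegative selfadjoint S and G ∈ GL(H) with G∘T ⊆ S∘G) and the resolvent set of T is nonempty; (ii) there exists X ∈ GL⁺(H) with X∘T = T*∘X as an equality of partial operators ({y : Xy ∈ dom T*} = dom T and X(Tx) = T*(Xx) for all x ∈ dom T) and σ(T) ⊆ [0,∞); (iii) T = X₁∘B₁ with X₁ ∈ GL⁺(H) and B₁ nonnegative selfadjoint; (iv) T = B∘X with B nonnegative selfadjoint and X ∈ GL⁺(H); (v) there exists W ∈ GL⁺(H) such that T∘W (domain {x : Wx ∈ dom T}) is nonnegative selfadjoint. Moreover, if one of these conditions holds, then closure(ran T) ∩ ker T = {0} and closure(ran T) + ker T = H. -/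
open scoped ComplexOrder
noncomputable section

local notation "⟪" x ", " y "⟫" => @inner ℂ _ _ x y

open Pointwise

section Statement15

variable {H : Type*} [NormedAddCommGroup H] [InnerProductSpace ℂ H] [CompleteSpace H]

/-- `G ∈ GL(H)`: a bounded everywhere-defined operator with a bounded everywhere-defined
two-sided inverse. -/
def IsInvertibleCLM (G : H →L[ℂ] H) : Prop :=
  ∃ G' : H →L[ℂ] H, G.comp G' = 1 ∧ G'.comp G = 1

/-- `μ` belongs to the resolvent set of `T`: `(T - μ)⁻¹` is a bounded everywhere-defined
operator. -/
def InResolvent (T : H →ₗ.[ℂ] H) (μ : ℂ) : Prop :=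
  ∃ R : H →L[ℂ] H, (∀ x : T.domain, R (T x - μ • (x : H)) = (x : H)) ∧
    ∀ y : H, ∃ h : R y ∈ T.domain, T ⟨R y, h⟩ - μ • R y = y

/-- (i): `T` is `W`-similar to a nonnegative selfadjoint operator and `ρ(T) ≠ ∅`. -/
def Cond15I (T : H →ₗ.[ℂ] H) : Prop :=
  (∃ (S : H →ₗ.[ℂ] H) (G : H →L[ℂ] H), IsNonnegSelfAdjoint S ∧ IsInvertibleCLM G ∧
    ∀ x : T.domain, ∃ h : G (x : H) ∈ S.domain, S ⟨G (x : H), h⟩ = G (T x)) ∧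
  ∃ μ : ℂ, InResolvent T μ

/-- `σ(T) ⊆ [0,∞)`: every `μ ∈ ℂ \ [0,∞)` is in the resolvent set of `T`. -/
def SpectrumNonneg (T : H →ₗ.[ℂ] H) : Prop :=
  ∀ μ : ℂ, (¬ ∃ r : ℝ, 0 ≤ r ∧ μ = (r : ℂ)) → InResolvent T μ

/-- (ii): `X ∘ T = T* ∘ X` for some `X ∈ GL⁺(H)` and `σ(T) ⊆ [0,∞)`. -/
def Cond15II (T : H →ₗ.[ℂ] H) : Prop :=
  (∃ X : H →L[ℂ] H, X.IsPositive ∧ IsInvertibleCLM X ∧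
    ∃ hiff : ∀ y : H, (X y ∈ T.adjoint.domain ↔ y ∈ T.domain),
      ∀ x : T.domain, X (T x) = T.adjoint ⟨X (x : H), (hiff (x : H)).mpr x.2⟩) ∧
  SpectrumNonneg T

/-- (iii): `T = X₁ ∘ B₁` with `X₁ ∈ GL⁺(H)` and `B₁` nonnegative selfadjoint. -/
def Cond15III (T : H →ₗ.[ℂ] H) : Prop :=
  ∃ (X₁ : H →L[ℂ] H) (B₁ : H →ₗ.[ℂ] H), X₁.IsPositive ∧ IsInvertibleCLM X₁ ∧
    IsNonnegSelfAdjoint B₁ ∧ ∃ hdom : B₁.domain = T.domain,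
      ∀ x : B₁.domain, T ⟨(x : H), hdom ▸ x.2⟩ = X₁ (B₁ x)

/-- (iv): `T = B ∘ X` with `B` nonnegative selfadjoint and `X ∈ GL⁺(H)`. -/
def Cond15IV (T : H →ₗ.[ℂ] H) : Prop :=
  ∃ (B : H →ₗ.[ℂ] H) (X : H →L[ℂ] H), IsNonnegSelfAdjoint B ∧ X.IsPositive ∧
    IsInvertibleCLM X ∧ ∃ hiff : ∀ x : H, (X x ∈ B.domain ↔ x ∈ T.domain),
      ∀ x : T.domain, T x = B ⟨X (x : H), (hiff (x : H)).mpr x.2⟩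

/-- (v): `T ∘ W` is nonnegative selfadjoint for some `W ∈ GL⁺(H)`. -/
def Cond15V (T : H →ₗ.[ℂ] H) : Prop :=
  ∃ W : H →L[ℂ] H, W.IsPositive ∧ IsInvertibleCLM W ∧
    IsNonnegSelfAdjoint (pcomp T (ofCLM W))

namespace LinearPMap

omit [CompleteSpace H] in
lemma forall_mem_graph_iff {T : H →ₗ.[ℂ] H} {P : H → H → Prop} :
    (∀ x y, (x, y) ∈ T.graph → P x y) ↔ ∀ x : T.domain, P x (T x) :=
  ⟨fun h x => h _ _ (T.mem_graph x), fun h x y hxy => by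
    obtain ⟨u, rfl, rfl⟩ := T.mem_graph_iff.mp hxy
    exact h u⟩

omit [CompleteSpace H] in
lemma mem_graph_iff_exists {T : H →ₗ.[ℂ] H} {x y : H} :
    (x, y) ∈ T.graph ↔ ∃ h : x ∈ T.domain, T ⟨x, h⟩ = y := by
  simp

lemma mem_graph_adjoint_iff {T : H →ₗ.[ℂ] H} (hT : Dense (T.domain : Set H)) {y w : H} :
    (y, w) ∈ T.adjoint.graph ↔ ∀ u v, (u, v) ∈ T.graph → ⟪w, u⟫ = ⟪y, v⟫ := by
  rw [adjoint_graph_eq_graph_adjoint hT, Submodule.mem_adjoint_iff]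
  refine forall_congr' fun u => forall_congr' fun v => imp_congr_right fun _ => ?_
  rw [sub_eq_zero, ← inner_conj_symm, ← inner_conj_symm u w,
    (starRingEnd ℂ).injective.eq_iff, eq_comm]

/-- A densely defined operator is selfadjoint iff membership in its graph is the adjoint relation. -/
lemma adjoint_eq_self_iff {T : H →ₗ.[ℂ] H} (hT : Dense (T.domain : Set H)) :
    T.adjoint = T ↔
      ∀ y w, (y, w) ∈ T.graph ↔ ∀ u v, (u, v) ∈ T.graph → ⟪w, u⟫ = ⟪y, v⟫ := by
  simp_rw [← mem_graph_adjoint_iff hT]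
  refine ⟨fun h => by simp [h], fun h => eq_of_eq_graph ?_⟩
  ext ⟨y, w⟩
  exact (h y w).symm

/-- The operator `L ∘ S ∘ e` with domain `{x : e x ∈ dom S}`. -/
def sandwich (L e : H ≃L[ℂ] H) (S : H →ₗ.[ℂ] H) : H →ₗ.[ℂ] H where
  domain := S.domain.comap (e : H →ₗ[ℂ] H)
  toFun := (L : H →ₗ[ℂ] H) ∘ₗ S.toFun ∘ₗ
    (e : H →ₗ[ℂ] H).restrict (p := S.domain.comap (e : H →ₗ[ℂ] H)) (q := S.domain) fun _ h => h

omit [CompleteSpace H] in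
lemma mem_graph_sandwich_iff {L e : H ≃L[ℂ] H} {S : H →ₗ.[ℂ] H} {x y : H} :
    (x, y) ∈ (sandwich L e S).graph ↔ (e x, L.symm y) ∈ S.graph := by
  rw [mem_graph_iff_exists, mem_graph_iff_exists]
  refine exists_congr fun h => ?_
  rw [L.eq_symm_apply]
  rfl

omit [CompleteSpace H] in
lemma dense_domain_sandwich {L e : H ≃L[ℂ] H} {S : H →ₗ.[ℂ] H}
    (hS : Dense (S.domain : Set H)) : Dense ((sandwich L e S).domain : Set H) :=
  hS.preimage e.toHomeomorph.isOpenMap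

end LinearPMap

open LinearPMap hiding map_add map_sub map_smul map_zero

omit [CompleteSpace H] in
lemma isInvertibleCLM_iff {G : H →L[ℂ] H} :
    IsInvertibleCLM G ↔ ∃ e : H ≃L[ℂ] H, (e : H →L[ℂ] H) = G := by
  constructor
  · rintro ⟨G', h₁, h₂⟩
    exact ⟨ContinuousLinearEquiv.equivOfInverse G G' (fun x => DFunLike.congr_fun h₂ x)
      (fun x => DFunLike.congr_fun h₁ x), rfl⟩
  · rintro ⟨e, rfl⟩
    exact ⟨e.symm, by ext; simp, by ext; simp⟩

lemma ContinuousLinearEquiv.exists_coe_eq_adjoint (e : H ≃L[ℂ] H) :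
    ∃ f : H ≃L[ℂ] H, ∀ x y : H, ⟪f x, y⟫ = ⟪x, e y⟫ := by
  obtain ⟨f, hf⟩ := isInvertibleCLM_iff.mp
    (⟨ContinuousLinearMap.adjoint (e.symm : H →L[ℂ] H), by
      rw [← ContinuousLinearMap.adjoint_comp, ContinuousLinearEquiv.coe_symm_comp_coe]
      exact star_one (H →L[ℂ] H), by
      rw [← ContinuousLinearMap.adjoint_comp, ContinuousLinearEquiv.coe_comp_coe_symm]
      exact star_one (H →L[ℂ] H)⟩ :
      IsInvertibleCLM (ContinuousLinearMap.adjoint (e : H →L[ℂ] H)))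
  refine ⟨f, fun x y => ?_⟩
  have : f x = ContinuousLinearMap.adjoint (e : H →L[ℂ] H) x := DFunLike.congr_fun hf x
  rw [this, ContinuousLinearMap.adjoint_inner_left]
  rfl

/-- The positive square root of an operator in `GL⁺(H)`. -/
lemma exists_symmetric_sqrt {X : H ≃L[ℂ] H} (hX : (X : H →L[ℂ] H).IsPositive) :
    ∃ A : H ≃L[ℂ] H, (∀ x y : H, ⟪A x, y⟫ = ⟪x, A y⟫) ∧ ∀ x, A (A x) = X x := by
  have h0 : 0 ≤ (X : H →L[ℂ] H) := (ContinuousLinearMap.nonneg_iff_isPositive _).mpr hX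
  have hu : IsUnit (CFC.sqrt (X : H →L[ℂ] H)) := (CFC.isUnit_sqrt_iff _ h0).mpr
    (ContinuousLinearMap.isUnit_iff_bijective.mpr X.bijective)
  obtain ⟨A, hA⟩ := isInvertibleCLM_iff.mp
    (⟨_, hu.mul_val_inv, hu.val_inv_mul⟩ : IsInvertibleCLM (CFC.sqrt (X : H →L[ℂ] H)))
  have hA' : ∀ x, A x = CFC.sqrt (X : H →L[ℂ] H) x := fun x => DFunLike.congr_fun hA x
  have hp := (ContinuousLinearMap.nonneg_iff_isPositive _).mp
    (CFC.sqrt_nonneg (X : H →L[ℂ] H))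
  refine ⟨A, fun x y => ?_, fun x => ?_⟩
  · rw [hA', hA', hp.inner_left_eq_inner_right]
  · rw [hA', hA']
    exact DFunLike.congr_fun (CFC.sqrt_mul_sqrt_self (X : H →L[ℂ] H) h0) x

omit [CompleteSpace H] in
lemma isPositive_of_eq_adjoint_comp {X : H →L[ℂ] H} {e f : H ≃L[ℂ] H}
    (hf : ∀ x y : H, ⟪f x, y⟫ = ⟪x, e y⟫) (hX : ∀ x, X x = f (e x)) : X.IsPositive := by
  rw [ContinuousLinearMap.isPositive_iff]
  refine ⟨fun x y => ?_, fun x => ?_⟩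
  · change ⟪X x, y⟫ = ⟪x, X y⟫
    rw [hX, hX, hf, ← inner_conj_symm x, hf, inner_conj_symm]
  · rw [hX, hf]
    exact ContinuousLinearMap.isPositive_one.inner_nonneg_left (e x)

omit [CompleteSpace H] in
lemma isPositive_symm {X : H ≃L[ℂ] H} (hX : (X : H →L[ℂ] H).IsPositive) :
    (X.symm : H →L[ℂ] H).IsPositive := by
  rw [ContinuousLinearMap.isPositive_iff]
  refine ⟨fun x y => ?_, fun x => ?_⟩
  · have := hX.inner_left_eq_inner_right (X.symm x) (X.symm y)
    simpa using this.symm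
  · simpa using hX.inner_nonneg_right (X.symm x)

lemma isNonnegSelfAdjoint_iff {S : H →ₗ.[ℂ] H} :
    IsNonnegSelfAdjoint S ↔ Dense (S.domain : Set H) ∧
      (∀ y w, (y, w) ∈ S.graph ↔ ∀ u v, (u, v) ∈ S.graph → ⟪w, u⟫ = ⟪y, v⟫) ∧
      ∀ x y, (x, y) ∈ S.graph → 0 ≤ ⟪y, x⟫ := by
  refine and_congr_right fun hd => and_congr (adjoint_eq_self_iff hd) ?_
  exact (forall_mem_graph_iff (P := fun x y => 0 ≤ ⟪y, x⟫)).symm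

lemma IsNonnegSelfAdjoint.sandwich {S : H →ₗ.[ℂ] H} (hS : IsNonnegSelfAdjoint S)
    {e f : H ≃L[ℂ] H} (hf : ∀ x y : H, ⟪f x, y⟫ = ⟪x, e y⟫) :
    IsNonnegSelfAdjoint (sandwich f e S) := by
  rw [isNonnegSelfAdjoint_iff] at hS ⊢
  obtain ⟨hd, hs, hn⟩ := hS
  have hf' : ∀ x y : H, ⟪e x, y⟫ = ⟪x, f y⟫ := fun x y => by
    rw [← inner_conj_symm, ← hf, inner_conj_symm]
  refine ⟨dense_domain_sandwich hd, fun y w => ?_, fun x y h => ?_⟩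
  · rw [mem_graph_sandwich_iff, hs]
    constructor
    · intro h u v huv
      have := h _ _ (mem_graph_sandwich_iff.mp huv)
      rwa [← hf, f.apply_symm_apply, hf', f.apply_symm_apply] at this
    · intro h u v huv
      have := h (e.symm u) (f v) (mem_graph_sandwich_iff.mpr (by simpa using huv))
      rw [← hf'] at this
      rw [← this]
      conv_rhs => rw [← f.apply_symm_apply w, hf, e.apply_symm_apply]
  · have := hn _ _ (mem_graph_sandwich_iff.mp h)
    rwa [← hf, f.apply_symm_apply] at this

omit [CompleteSpace H] in
lemma inResolvent_iff {T : H →ₗ.[ℂ] H} {μ : ℂ} :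
    InResolvent T μ ↔ ∃ R : H →L[ℂ] H, (∀ x y, (x, y) ∈ T.graph → R (y - μ • x) = x) ∧
      ∀ y, (R y, y + μ • R y) ∈ T.graph := by
  refine exists_congr fun R => and_congr
    (forall_mem_graph_iff (P := fun x y => R (y - μ • x) = x)).symm ?_
  simp_rw [mem_graph_iff_exists, sub_eq_iff_eq_add]

omit [CompleteSpace H] in
lemma InResolvent.of_similar {S T : H →ₗ.[ℂ] H} {e : H ≃L[ℂ] H}
    (h : ∀ x y, (x, y) ∈ T.graph ↔ (e x, e y) ∈ S.graph) {μ : ℂ} (hS : InResolvent S μ) :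
    InResolvent T μ := by
  rw [inResolvent_iff] at hS ⊢
  obtain ⟨R, h₁, h₂⟩ := hS
  refine ⟨(e.symm : H →L[ℂ] H) ∘L R ∘L (e : H →L[ℂ] H), fun x y hxy => ?_, fun y => ?_⟩
  · have := h₁ _ _ ((h x y).mp hxy)
    rw [← map_smul, ← map_sub] at this
    change e.symm (R (e (y - μ • x))) = x
    rw [this, e.symm_apply_apply]
  · rw [h]
    simpa using h₂ (e y)

/-- Lower bound for the quadratic form of `S - μ` when `S ≥ 0` and `μ ∉ [0, ∞)`. -/
lemma exists_pos_mul_le_norm_sub {μ : ℂ} (hμ : ¬ ∃ r : ℝ, 0 ≤ r ∧ μ = (r : ℂ)) :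
    ∃ c : ℝ, 0 < c ∧ ∀ r n : ℝ, 0 ≤ r → 0 ≤ n → c * n ≤ ‖(r : ℂ) - μ * n‖ := by
  by_cases him : μ.im = 0
  · have hre : μ.re < 0 := by
      by_contra! h
      exact hμ ⟨μ.re, h, Complex.ext (by simp) (by simp [him])⟩
    refine ⟨-μ.re, by linarith, fun r n hr hn => ?_⟩
    refine le_trans ?_ (Complex.re_le_norm _)
    simp
    linarith
  · refine ⟨|μ.im|, abs_pos.mpr him, fun r n hr hn => ?_⟩
    refine le_trans ?_ (Complex.abs_im_le_norm _)
    simp [abs_mul, abs_of_nonneg hn]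

/-- The spectrum of a nonnegative selfadjoint operator is contained in `[0, ∞)`. -/
lemma IsNonnegSelfAdjoint.spectrumNonneg {S : H →ₗ.[ℂ] H} (hS : IsNonnegSelfAdjoint S) :
    SpectrumNonneg S := by
  intro μ hμ
  have hclosed : IsClosed (S.graph : Set (H × H)) :=
    IsSelfAdjoint.isClosed (isSelfAdjoint_def.mpr hS.2.1)
  rw [isNonnegSelfAdjoint_iff] at hS
  obtain ⟨hd, hs, hn⟩ := hS
  obtain ⟨c, hc, hbound⟩ := exists_pos_mul_le_norm_sub hμ
  have hlow : ∀ x y, (x, y) ∈ S.graph → c * ‖x‖ ≤ ‖y - μ • x‖ := by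
    intro x y hxy
    rcases eq_or_ne x 0 with rfl | hx
    · simp
    have hpos : 0 < ‖x‖ := norm_pos_iff.mpr hx
    obtain ⟨hre, him⟩ := Complex.nonneg_iff.mp (hn x y hxy)
    have hyx : ⟪x, y⟫ = ((⟪y, x⟫).re : ℂ) := by
      rw [← inner_conj_symm, Complex.conj_eq_iff_im.mpr him.symm]
      exact Complex.ext rfl him.symm
    have h1 := hbound _ (‖x‖ ^ 2) hre (by positivity)
    have h2 : ((⟪y, x⟫).re : ℂ) - μ * ((‖x‖ ^ 2 : ℝ) : ℂ) = ⟪x, y - μ • x⟫ := by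
      rw [inner_sub_right, inner_smul_right, hyx, inner_self_eq_norm_sq_to_K]
      push_cast
      rfl
    rw [h2] at h1
    have h3 := h1.trans (norm_inner_le_norm _ _)
    nlinarith
  have : CompleteSpace S.graph := hclosed.completeSpace_coe
  let f : S.graph →L[ℂ] H :=
    (ContinuousLinearMap.snd ℂ H H - μ • ContinuousLinearMap.fst ℂ H H) ∘L S.graph.subtypeL
  have hf : ∀ p : S.graph, f p = p.1.2 - μ • p.1.1 := fun p => rfl
  have hanti : ∀ p : S.graph, ‖p‖ ≤ (c⁻¹ + (1 + ‖μ‖ * c⁻¹)) * ‖f p‖ := by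
    rintro ⟨⟨x, y⟩, hxy⟩
    have h1 := hlow x y hxy
    have hx : ‖x‖ ≤ c⁻¹ * ‖y - μ • x‖ := by
      rwa [inv_mul_eq_div, le_div_iff₀ hc, mul_comm]
    have hy : ‖y‖ ≤ ‖y - μ • x‖ + ‖μ‖ * ‖x‖ := by
      rw [← norm_smul]
      simpa using norm_add_le (y - μ • x) (μ • x)
    have hy' := mul_le_mul_of_nonneg_left hx (norm_nonneg μ)
    have hc' : 0 ≤ c⁻¹ * ‖y - μ • x‖ := by positivity
    have hc'' : 0 ≤ ‖μ‖ * (c⁻¹ * ‖y - μ • x‖) := by positivity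
    rw [hf]
    change max ‖x‖ ‖y‖ ≤ _ * ‖y - μ • x‖
    apply max_le <;> nlinarith [norm_nonneg (y - μ • x)]
  have hK : 0 ≤ c⁻¹ + (1 + ‖μ‖ * c⁻¹) := by positivity
  have hantil : AntilipschitzWith ⟨_, hK⟩ f := f.antilipschitz_of_bound hanti
  have hrange : IsClosed (f.range : Set H) := by
    exact hantil.isClosed_range f.uniformContinuous
  have hcomp : CompleteSpace f.range := hrange.completeSpace_coe
  have htop : f.range = ⊤ := by
    rw [← Submodule.orthogonal_eq_bot_iff, Submodule.eq_bot_iff]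
    intro w hw
    have hmem : (w, (starRingEnd ℂ) μ • w) ∈ S.graph := by
      rw [hs]
      intro u v huv
      have h0 : ⟪v - μ • u, w⟫ = 0 := hw _ ⟨⟨(u, v), huv⟩, rfl⟩
      rw [← inner_conj_symm, map_eq_zero, inner_sub_right, inner_smul_right, sub_eq_zero] at h0
      rw [inner_smul_left, h0, Complex.conj_conj]
    have h1 := hn _ _ hmem
    rw [inner_smul_left, Complex.conj_conj, inner_self_eq_norm_sq_to_K] at h1
    by_contra hw0
    have hpos : 0 < ‖w‖ ^ 2 := by positivity
    have h2 := hlow _ _ hmem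
    obtain ⟨hre, him⟩ := Complex.nonneg_iff.mp h1
    have e1 : (μ * ((‖w‖ : ℂ)) ^ 2) = μ * ((‖w‖ ^ 2 : ℝ) : ℂ) := by push_cast; rfl
    change 0 ≤ (μ * ((‖w‖ : ℂ)) ^ 2).re at hre
    change 0 = (μ * ((‖w‖ : ℂ)) ^ 2).im at him
    rw [e1, Complex.re_mul_ofReal] at hre
    rw [e1, Complex.im_mul_ofReal] at him
    refine hμ ⟨μ.re, nonneg_of_mul_nonneg_left hre hpos, Complex.ext (by simp) ?_⟩
    rcases mul_eq_zero.mp him.symm with h | h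
    · simpa using h
    · exact absurd h hpos.ne'
  have hinj : f.ker = ⊥ := LinearMap.ker_eq_bot.mpr hantil.injective
  let E := ContinuousLinearEquiv.ofBijective f hinj htop
  have hE : ∀ y, f (E.symm y) = y :=
    ContinuousLinearEquiv.ofBijective_apply_symm_apply f hinj htop
  rw [inResolvent_iff]
  refine ⟨ContinuousLinearMap.fst ℂ H H ∘L S.graph.subtypeL ∘L (E.symm : H →L[ℂ] S.graph),
    fun x y hxy => ?_, fun y => ?_⟩
  · have h1 : E.symm (f ⟨(x, y), hxy⟩) = ⟨(x, y), hxy⟩ :=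
      ContinuousLinearEquiv.ofBijective_symm_apply_apply f hinj htop _
    change (E.symm (f ⟨(x, y), hxy⟩)).1.1 = x
    rw [h1]
  · change ((E.symm y).1.1, y + μ • (E.symm y).1.1) ∈ S.graph
    have h1 := hE y
    rw [hf, sub_eq_iff_eq_add] at h1
    rw [← h1]
    exact (E.symm y).2

/-- A selfadjoint operator with spectrum in `[0, ∞)` is nonnegative. -/
lemma isNonnegSelfAdjoint_of_spectrumNonneg {S : H →ₗ.[ℂ] H} (hd : Dense (S.domain : Set H))
    (hs : S.adjoint = S) (hσ : SpectrumNonneg S) : IsNonnegSelfAdjoint S := by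
  rw [adjoint_eq_self_iff hd] at hs
  refine isNonnegSelfAdjoint_iff.mpr ⟨hd, hs, ?_⟩
  have hneg : ∀ r : ℝ, r < 0 → InResolvent S (r : ℂ) := by
    refine fun r hr => hσ _ ?_
    rintro ⟨s, hs0, hrs⟩
    have : r = s := by exact_mod_cast hrs
    linarith
  have key : ∀ t : ℝ, 0 < t → ∀ x y, (x, y) ∈ S.graph → 0 ≤ ⟪x, y + (t : ℂ) • x⟫ := by
    intro t ht
    obtain ⟨R, hR₁, hR₂⟩ := inResolvent_iff.mp (hneg (-t) (by linarith))
    have hsym : ∀ u v, ⟪R u, v⟫ = ⟪u, R v⟫ := by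
      intro u v
      have := (hs _ _).mp (hR₂ u) _ _ (hR₂ v)
      simpa [inner_add_left, inner_add_right, inner_smul_left, inner_smul_right,
        eq_comm] using this
    have hsa : IsSelfAdjoint R := ContinuousLinearMap.isSelfAdjoint_iff_isSymmetric.mpr hsym
    have hpos : 0 ≤ R := by
      rw [StarOrderedRing.nonneg_iff_spectrum_nonneg (R := ℝ) R hsa]
      intro l hl
      by_contra! hl0
      have hlC : (l : ℂ) ≠ 0 := by exact_mod_cast hl0.ne
      have hl' : l⁻¹ < 0 := inv_lt_zero.mpr hl0
      obtain ⟨Q, hQ₁, hQ₂⟩ := inResolvent_iff.mp (hneg (l⁻¹ - t) (by linarith))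
      have e₁ : ∀ v, R v + (l : ℂ)⁻¹ • R (Q v) = Q v := by
        intro v
        rw [← map_smul, ← map_add]
        refine Eq.trans (congrArg R ?_) (hR₁ _ _ (hQ₂ v))
        push_cast
        module
      have e₂ : ∀ v, Q v - (l : ℂ)⁻¹ • Q (R v) = R v := by
        intro v
        rw [← map_smul, ← map_sub]
        refine Eq.trans (congrArg Q ?_) (hQ₁ _ _ (hR₂ v))
        push_cast
        module
      refine hl (ContinuousLinearMap.isUnit_iff_bijective.mpr ?_)
      have hap : ∀ v, (algebraMap ℝ (H →L[ℂ] H) l - R) v = (l : ℂ) • v - R v := by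
        intro v
        simp [Algebra.algebraMap_eq_smul_one]
      refine Function.bijective_iff_has_inverse.mpr
        ⟨fun v => (l : ℂ)⁻¹ • (v + (l : ℂ)⁻¹ • Q v), fun v => ?_, fun v => ?_⟩
      · simp only [hap, map_sub, map_smul, smul_add, smul_sub, inv_smul_smul₀ hlC]
        linear_combination (norm := module) (l : ℂ)⁻¹ • e₂ v
      · simp only [hap, map_add, map_smul, smul_add, smul_inv_smul₀ hlC]
        linear_combination (norm := module) -(l : ℂ)⁻¹ • e₁ v
    intro x y hxy
    have h1 : R (y + (t : ℂ) • x) = x := by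
      refine Eq.trans (congrArg R ?_) (hR₁ _ _ hxy)
      push_cast
      module
    have h2 := ((ContinuousLinearMap.nonneg_iff_isPositive R).mp hpos).inner_nonneg_left
      (y + (t : ℂ) • x)
    rwa [h1] at h2
  intro x y hxy
  have hsymm : ⟪y, x⟫ = ⟪x, y⟫ := (hs _ _).mp hxy _ _ hxy
  rw [hsymm, Complex.nonneg_iff]
  constructor
  · refine le_of_forall_pos_le_add fun ε hε => ?_
    have hx : 0 < ‖x‖ ^ 2 + 1 := by positivity
    have h1 := (Complex.nonneg_iff.mp (key (ε / (‖x‖ ^ 2 + 1)) (by positivity) x y hxy)).1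
    rw [inner_add_right, inner_smul_right, Complex.add_re, Complex.re_ofReal_mul] at h1
    have h2 : (⟪x, x⟫).re = ‖x‖ ^ 2 := inner_self_eq_norm_sq (𝕜 := ℂ) x
    rw [h2] at h1
    have h3 : ε / (‖x‖ ^ 2 + 1) * ‖x‖ ^ 2 ≤ ε := by
      rw [div_mul_eq_mul_div, div_le_iff₀ hx]
      nlinarith
    linarith
  · have := congrArg Complex.im (inner_conj_symm x y)
    rw [hsymm, Complex.conj_im] at this
    linarith

/-- `T = e⁻¹ ∘ S ∘ e` for a nonnegative selfadjoint `S`. -/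
def IsSimilarVia (T S : H →ₗ.[ℂ] H) (e : H ≃L[ℂ] H) : Prop :=
  IsNonnegSelfAdjoint S ∧ ∀ x y, (x, y) ∈ T.graph ↔ (e x, e y) ∈ S.graph

lemma cond15I_iff {T : H →ₗ.[ℂ] H} : Cond15I T ↔ ∃ S e, IsSimilarVia T S e := by
  constructor
  · rintro ⟨⟨S, G, hS, hG, h⟩, μ, hμ⟩
    obtain ⟨e, rfl⟩ := isInvertibleCLM_iff.mp hG
    obtain ⟨R, hR₁, hR₂⟩ := inResolvent_iff.mp hμ
    have hTS : ∀ x y, (x, y) ∈ T.graph → (e x, e y) ∈ S.graph :=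
      forall_mem_graph_iff.mpr fun x => mem_graph_iff_exists.mpr (h x)
    refine ⟨S, e, hS, fun x y => ⟨hTS x y, fun hxy => ?_⟩⟩
    obtain ⟨hd, hs, -⟩ := isNonnegSelfAdjoint_iff.mp hS
    have hu := hR₂ (y - μ • x)
    set u := R (y - μ • x)
    have hmem : (e (x - u), μ • e (x - u)) ∈ S.graph := by
      have := S.graph.sub_mem hxy (hTS _ _ hu)
      convert this using 1
      ext
      · simp
      · simp only [map_sub, map_add, map_smul, Prod.snd_sub]
        module
    set w := e (x - u) with hw
    have h1 : ⟪μ • w, w⟫ = ⟪w, μ • w⟫ := (hs _ _).mp hmem _ _ hmem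
    have h2 := (hs _ _).mp hmem _ _ (hTS _ _ (hR₂ (e.symm w)))
    have hw0 : w = 0 := by
      by_contra hne
      rw [inner_smul_left, inner_smul_right] at h1
      have h3 := mul_right_cancel₀ (inner_self_ne_zero.mpr hne) h1
      rw [map_add, map_smul, e.apply_symm_apply, inner_smul_left, h3, inner_add_right,
        inner_smul_right] at h2
      exact inner_self_ne_zero.mpr hne (by linear_combination -h2)
    have hxu : x = u := by
      rw [hw, map_eq_zero_iff e e.injective, sub_eq_zero] at hw0
      exact hw0
    rw [← hxu] at hu
    simpa using hu
  · rintro ⟨S, e, hS, h⟩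
    refine ⟨⟨S, e, hS, isInvertibleCLM_iff.mpr ⟨e, rfl⟩, fun x => ?_⟩, -1, ?_⟩
    · exact mem_graph_iff_exists.mp ((h _ _).mp (T.mem_graph x))
    · refine InResolvent.of_similar h (hS.spectrumNonneg _ ?_)
      rintro ⟨r, hr, h1⟩
      have : (-1 : ℝ) = r := by exact_mod_cast h1
      linarith

lemma cond15II_iff {T : H →ₗ.[ℂ] H} : Cond15II T ↔
    (∃ X : H ≃L[ℂ] H, (X : H →L[ℂ] H).IsPositive ∧
      ∀ x y, (x, y) ∈ T.graph ↔ (X x, X y) ∈ T.adjoint.graph) ∧ SpectrumNonneg T := by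
  refine and_congr_left fun _ => ⟨?_, ?_⟩
  · rintro ⟨X, hX, hi, hiff, h⟩
    obtain ⟨X, rfl⟩ := isInvertibleCLM_iff.mp hi
    refine ⟨X, hX, fun x y => ?_⟩
    rw [mem_graph_iff_exists, mem_graph_iff_exists]
    refine ⟨?_, ?_⟩
    · rintro ⟨hx, rfl⟩
      exact ⟨(hiff x).mpr hx, (h ⟨x, hx⟩).symm⟩
    · rintro ⟨hx, hy⟩
      exact ⟨(hiff x).mp hx, X.injective ((h ⟨x, (hiff x).mp hx⟩).trans hy)⟩
  · rintro ⟨X, hX, h⟩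
    refine ⟨X, hX, isInvertibleCLM_iff.mpr ⟨X, rfl⟩, fun y => ⟨fun hy => ?_, fun hy => ?_⟩,
      fun x => ?_⟩
    · have := T.adjoint.mem_graph ⟨X y, hy⟩
      exact mem_domain_of_mem_graph ((h y (X.symm (T.adjoint ⟨X y, hy⟩))).mpr (by simpa using this))
    · exact mem_domain_of_mem_graph ((h _ _).mp (T.mem_graph ⟨y, hy⟩))
    · obtain ⟨_, h'⟩ := mem_graph_iff_exists.mp ((h _ _).mp (T.mem_graph x))
      exact h'.symm

lemma cond15III_iff {T : H →ₗ.[ℂ] H} : Cond15III T ↔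
    ∃ (X : H ≃L[ℂ] H) (B : H →ₗ.[ℂ] H), (X : H →L[ℂ] H).IsPositive ∧ IsNonnegSelfAdjoint B ∧
      ∀ x y, (x, X y) ∈ T.graph ↔ (x, y) ∈ B.graph := by
  constructor
  · rintro ⟨X, B, hX, hi, hB, hdom, h⟩
    obtain ⟨X, rfl⟩ := isInvertibleCLM_iff.mp hi
    refine ⟨X, B, hX, hB, fun x y => ?_⟩
    rw [mem_graph_iff_exists, mem_graph_iff_exists]
    refine ⟨?_, ?_⟩
    · rintro ⟨hx, hy⟩
      exact ⟨hdom ▸ hx, X.injective ((h ⟨x, hdom ▸ hx⟩).symm.trans hy)⟩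
    · rintro ⟨hx, rfl⟩
      exact ⟨hdom ▸ hx, h ⟨x, hx⟩⟩
  · rintro ⟨X, B, hX, hB, h⟩
    refine ⟨X, B, hX, isInvertibleCLM_iff.mpr ⟨X, rfl⟩, hB, ?_, fun x => ?_⟩
    · ext x
      refine ⟨fun hx => mem_domain_of_mem_graph ((h _ _).mpr (B.mem_graph ⟨x, hx⟩)), fun hx =>
        mem_domain_of_mem_graph ((h x (X.symm (T ⟨x, hx⟩))).mp ?_)⟩
      simpa using T.mem_graph ⟨x, hx⟩
    · obtain ⟨_, h'⟩ := mem_graph_iff_exists.mp ((h _ _).mpr (B.mem_graph x))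
      exact h'

lemma cond15IV_iff {T : H →ₗ.[ℂ] H} : Cond15IV T ↔
    ∃ (X : H ≃L[ℂ] H) (B : H →ₗ.[ℂ] H), (X : H →L[ℂ] H).IsPositive ∧ IsNonnegSelfAdjoint B ∧
      ∀ x y, (x, y) ∈ T.graph ↔ (X x, y) ∈ B.graph := by
  constructor
  · rintro ⟨B, X, hB, hX, hi, hiff, h⟩
    obtain ⟨X, rfl⟩ := isInvertibleCLM_iff.mp hi
    refine ⟨X, B, hX, hB, fun x y => ?_⟩
    rw [mem_graph_iff_exists, mem_graph_iff_exists]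
    refine ⟨?_, ?_⟩
    · rintro ⟨hx, rfl⟩
      exact ⟨(hiff x).mpr hx, (h ⟨x, hx⟩).symm⟩
    · rintro ⟨hx, rfl⟩
      exact ⟨(hiff x).mp hx, h ⟨x, (hiff x).mp hx⟩⟩
  · rintro ⟨X, B, hX, hB, h⟩
    refine ⟨B, X, hB, hX, isInvertibleCLM_iff.mpr ⟨X, rfl⟩, fun x => ⟨fun hx => ?_, fun hx => ?_⟩,
      fun x => ?_⟩
    · exact mem_domain_of_mem_graph ((h _ _).mpr (B.mem_graph ⟨X x, hx⟩))
    · exact mem_domain_of_mem_graph ((h _ _).mp (T.mem_graph ⟨x, hx⟩))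
    · obtain ⟨_, h'⟩ := mem_graph_iff_exists.mp ((h _ _).mp (T.mem_graph x))
      exact h'.symm

omit [CompleteSpace H] in
lemma mem_graph_pcomp_ofCLM_iff {T : H →ₗ.[ℂ] H} {W : H →L[ℂ] H} {x y : H} :
    (x, y) ∈ (pcomp T (ofCLM W)).graph ↔ (W x, y) ∈ T.graph := by
  have hval : ∀ (h : x ∈ (pcomp T (ofCLM W)).domain) (h' : W x ∈ T.domain),
      pcomp T (ofCLM W) ⟨x, h⟩ = T ⟨W x, h'⟩ := by
    intro h h'
    have hx : (Submodule.equivMapOfInjective (ofCLM W).domain.subtype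
        (Submodule.injective_subtype _) (T.domain.comap (ofCLM W).toFun)).symm ⟨x, h⟩ =
        ⟨⟨x, trivial⟩, h'⟩ := by
      rw [LinearEquiv.symm_apply_eq]
      rfl
    exact congrArg (fun u => T.toFun ((ofCLM W).toFun.restrict
      (p := T.domain.comap (ofCLM W).toFun) (q := T.domain) (fun _ hu => hu) u)) hx
  rw [mem_graph_iff_exists, mem_graph_iff_exists]
  have hmem : x ∈ (pcomp T (ofCLM W)).domain ↔ W x ∈ T.domain := by
    constructor
    · rintro ⟨u, hu, rfl⟩
      exact hu
    · intro h
      exact ⟨⟨x, trivial⟩, h, rfl⟩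
  exact ⟨fun ⟨h, e⟩ => ⟨hmem.mp h, (hval h _).symm.trans e⟩,
    fun ⟨h, e⟩ => ⟨hmem.mpr h, (hval _ h).trans e⟩⟩

lemma cond15V_iff_cond15IV {T : H →ₗ.[ℂ] H} : Cond15V T ↔ Cond15IV T := by
  rw [cond15IV_iff]
  constructor
  · rintro ⟨W, hW, hi, h⟩
    obtain ⟨W, rfl⟩ := isInvertibleCLM_iff.mp hi
    refine ⟨W.symm, _, isPositive_symm hW, h, fun x y => ?_⟩
    simp [mem_graph_pcomp_ofCLM_iff, -mem_graph_iff]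
  · rintro ⟨X, B, hX, hB, h⟩
    refine ⟨X.symm, isPositive_symm hX, isInvertibleCLM_iff.mpr ⟨X.symm, rfl⟩, ?_⟩
    convert hB
    refine eq_of_eq_graph ?_
    ext ⟨x, y⟩
    rw [mem_graph_pcomp_ofCLM_iff, h]
    simp [-mem_graph_iff]

lemma IsSimilarVia.cond15II {T S : H →ₗ.[ℂ] H} {e : H ≃L[ℂ] H} (hT : Dense (T.domain : Set H))
    (h : IsSimilarVia T S e) : Cond15II T := by
  obtain ⟨hS, h⟩ := h
  refine cond15II_iff.mpr ⟨?_, fun μ hμ => (hS.spectrumNonneg μ hμ).of_similar h⟩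
  obtain ⟨f, hf⟩ := e.exists_coe_eq_adjoint
  refine ⟨e.trans f, isPositive_of_eq_adjoint_comp hf fun _ => rfl, fun x y => ?_⟩
  rw [mem_graph_adjoint_iff hT, h, (isNonnegSelfAdjoint_iff.mp hS).2.1]
  simp only [ContinuousLinearEquiv.trans_apply, hf, h]
  refine ⟨fun H u v huv => H _ _ huv, fun H u v huv => ?_⟩
  simpa using H (e.symm u) (e.symm v) (by simpa using huv)

lemma Cond15II.exists_isSimilarVia {T : H →ₗ.[ℂ] H} (hT : Dense (T.domain : Set H))
    (h : Cond15II T) : ∃ S e, IsSimilarVia T S e := by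
  obtain ⟨⟨X, hX, h⟩, hσ⟩ := cond15II_iff.mp h
  obtain ⟨A, hA, hAX⟩ := exists_symmetric_sqrt hX
  have hg : ∀ x y, (x, y) ∈ (sandwich A A.symm T).graph ↔ (A.symm x, A.symm y) ∈ T.graph :=
    fun x y => mem_graph_sandwich_iff
  refine ⟨sandwich A A.symm T, A, ?_, fun x y => by simp [hg, -mem_graph_iff]⟩
  refine isNonnegSelfAdjoint_of_spectrumNonneg (dense_domain_sandwich hT) ?_
    fun μ hμ => (hσ μ hμ).of_similar hg
  rw [adjoint_eq_self_iff (dense_domain_sandwich hT)]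
  intro y w
  rw [hg, h, mem_graph_adjoint_iff hT]
  simp only [← hAX, A.apply_symm_apply, hA, hg]
  refine ⟨fun H u v huv => ?_, fun H u v huv => H _ _ (by simpa using huv)⟩
  simpa using H _ _ huv

lemma IsSimilarVia.cond15III {T S : H →ₗ.[ℂ] H} {e : H ≃L[ℂ] H} (h : IsSimilarVia T S e) :
    Cond15III T := by
  obtain ⟨hS, h⟩ := h
  obtain ⟨f, hf⟩ := e.exists_coe_eq_adjoint
  refine cond15III_iff.mpr ⟨(e.trans f).symm, sandwich f e S,
    isPositive_symm (isPositive_of_eq_adjoint_comp hf fun _ => rfl), hS.sandwich hf,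
    fun x y => ?_⟩
  rw [mem_graph_sandwich_iff, h]
  simp [-mem_graph_iff]

lemma Cond15III.exists_isSimilarVia {T : H →ₗ.[ℂ] H} (h : Cond15III T) :
    ∃ S e, IsSimilarVia T S e := by
  obtain ⟨X, B, hX, hB, h⟩ := cond15III_iff.mp h
  obtain ⟨A, hA, hAX⟩ := exists_symmetric_sqrt hX
  refine ⟨sandwich A A B, A.symm, hB.sandwich hA, fun x y => ?_⟩
  rw [mem_graph_sandwich_iff, ← h, ← hAX]
  simp [-mem_graph_iff]

lemma cond15III_iff_cond15IV {T : H →ₗ.[ℂ] H} : Cond15III T ↔ Cond15IV T := by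
  rw [cond15III_iff, cond15IV_iff]
  constructor
  · rintro ⟨X, B, hX, hB, h⟩
    refine ⟨X.symm, sandwich X X B, isPositive_symm hX,
      hB.sandwich hX.inner_left_eq_inner_right, fun x y => ?_⟩
    rw [mem_graph_sandwich_iff, ← h]
    simp [-mem_graph_iff]
  · rintro ⟨X, B, hX, hB, h⟩
    refine ⟨X.symm, sandwich X X B, isPositive_symm hX,
      hB.sandwich hX.inner_left_eq_inner_right, fun x y => ?_⟩
    rw [mem_graph_sandwich_iff, h]

/-- The range of a selfadjoint operator has the kernel as orthogonal complement; this passes to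
similar operators as a (non-orthogonal) topological decomposition. -/
lemma IsSimilarVia.closure_range_inter_ker_and_add {T S : H →ₗ.[ℂ] H} {e : H ≃L[ℂ] H}
    (h : IsSimilarVia T S e) :
    closure (Set.range fun x : T.domain => T x) ∩
        {x : H | ∃ h : x ∈ T.domain, T ⟨x, h⟩ = 0} = {0} ∧
    closure (Set.range fun x : T.domain => T x) +
        {x : H | ∃ h : x ∈ T.domain, T ⟨x, h⟩ = 0} = Set.univ := by
  obtain ⟨hS, h⟩ := h
  have hs := (isNonnegSelfAdjoint_iff.mp hS).2.1
  let M : Submodule ℂ H := S.graph.map (LinearMap.snd ℂ H H)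
  have hM : ∀ w, w ∈ Mᗮ ↔ (w, 0) ∈ S.graph := by
    intro w
    rw [hs, Submodule.mem_orthogonal']
    constructor
    · intro hw u v huv
      rw [inner_zero_left, hw v ⟨(u, v), huv, rfl⟩]
    · rintro hw _ ⟨⟨u, v⟩, huv, rfl⟩
      simpa using (hw u v huv).symm
  have hker : {x : H | ∃ h : x ∈ T.domain, T ⟨x, h⟩ = 0} = e ⁻¹' (Mᗮ : Set H) := by
    ext x
    rw [Set.mem_preimage, SetLike.mem_coe, hM]
    conv_rhs => rw [← map_zero e, ← h, mem_graph_iff_exists]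
    rfl
  have hran : (Set.range fun x : T.domain => T x) = e ⁻¹' (M : Set H) := by
    ext y
    constructor
    · rintro ⟨x, rfl⟩
      exact ⟨_, (h _ _).mp (T.mem_graph x), rfl⟩
    · rintro ⟨⟨u, v⟩, huv, rfl : v = e y⟩
      obtain ⟨hx, hy⟩ := mem_graph_iff_exists.mp
        ((h (e.symm u) y).mpr (by simpa using huv))
      exact ⟨_, hy⟩
  have hcl : closure (Set.range fun x : T.domain => T x) = e ⁻¹' (Mᗮᗮ : Set H) := by
    rw [hran, Submodule.orthogonal_orthogonal_eq_closure, Submodule.topologicalClosure_coe]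
    exact (e.toHomeomorph.preimage_closure _).symm
  rw [hcl, hker]
  constructor
  · ext x
    simp only [Set.mem_inter_iff, Set.mem_preimage, SetLike.mem_coe, Set.mem_singleton_iff]
    constructor
    · rintro ⟨h₁, h₂⟩
      exact (map_eq_zero_iff e e.injective).mp (inner_self_eq_zero.mp (h₁ _ h₂))
    · rintro rfl
      simp
  · refine Set.eq_univ_of_forall fun x => ?_
    obtain ⟨a, ha, b, hb, hab⟩ := Mᗮ.exists_add_mem_mem_orthogonal (e x)
    refine Set.mem_add.mpr ⟨e.symm b, by simpa using hb, e.symm a, by simpa using ha, ?_⟩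
    rw [← map_add, add_comm, ← hab, e.symm_apply_apply]

/-- for a closed densely defined `T`, conditions (i)-(v) are equivalent, and they
imply `closure (ran T) ∩ ker T = {0}` and `closure (ran T) + ker T = H`. -/
theorem statement15
    (T : H →ₗ.[ℂ] H) (hT : T.IsClosed) (hTd : Dense (T.domain : Set H)) :
    (Cond15I T ↔ Cond15II T) ∧
    (Cond15I T ↔ Cond15III T) ∧
    (Cond15I T ↔ Cond15IV T) ∧
    (Cond15I T ↔ Cond15V T) ∧
    (Cond15I T →
      closure (Set.range fun x : T.domain => T x) ∩
          {x : H | ∃ h : x ∈ T.domain, T ⟨x, h⟩ = 0} = {0} ∧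
      closure (Set.range fun x : T.domain => T x) +
          {x : H | ∃ h : x ∈ T.domain, T ⟨x, h⟩ = 0} = Set.univ) := by
  rw [cond15I_iff]
  refine ⟨⟨fun ⟨_, _, h⟩ => h.cond15II hTd, fun h => h.exists_isSimilarVia hTd⟩, ?_⟩
  have hIII : (∃ S e, IsSimilarVia T S e) ↔ Cond15III T :=
    ⟨fun ⟨_, _, h⟩ => h.cond15III, fun h => h.exists_isSimilarVia⟩
  exact ⟨hIII, hIII.trans cond15III_iff_cond15IV,
    hIII.trans (cond15III_iff_cond15IV.trans cond15V_iff_cond15IV.symm),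
    fun ⟨_, _, h⟩ => h.closure_range_inter_ker_and_add⟩

end Statement15
end
end

section
/- Let T be a closed densely defined operator on H that is quasi-similar to a nonnegative selfadjoint operator S (there exist quasi-affinities G₁, G₂ with G₁∘T ⊆ S∘G₁ and G₂∘S ⊆ T∘G₂). Then T is squeezed between a product from L²₊ and a product from L²₋: there exist A₁ ∈ L⁺(H) and a nonnegative selfadjoint operator B₁ with A₁∘B₁ ⊆ T (dom B₁ ⊆ dom T and Tx = A₁(B₁x) for x ∈ dom B₁), and there exist an injective W ∈ L⁺(H) and a nonnegative selfadjoint operator A₂ with dom T ⊆ dom A₂ and W(Tx) = A₂x for all x ∈ dom T (i.e. T ⊆ W⁻¹∘A₂, a product B₂∘A₂ with B₂⁻¹ = W ∈ L⁺(H)). -/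
open scoped ComplexOrder
noncomputable section

local notation "⟪" x ", " y "⟫" => @inner ℂ _ _ x y

open ContinuousLinearMap in
/-- The conjugate `G† R G` of a strictly positive operator by an injective one is injective. -/
theorem injective_adjoint_conj {H : Type*} [NormedAddCommGroup H] [InnerProductSpace ℂ H]
    [CompleteSpace H] {R G : H →L[ℂ] H} (hR : ∀ x, inner ℂ (R x) x = 0 → x = 0)
    (hG : Function.Injective G) : Function.Injective (adjoint G ∘L R ∘L G) := by
  rw [injective_iff_map_eq_zero]
  intro x hx
  apply (injective_iff_map_eq_zero G).1 hG
  apply hR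
  rw [← adjoint_inner_left]
  have : adjoint G (R (G x)) = 0 := hx
  rw [this, inner_zero_left]

namespace LinearPMap

variable {H : Type*} [NormedAddCommGroup H] [InnerProductSpace ℂ H]

/-- The inverse of an injective bounded operator, defined on its range. -/
def ofInjectiveInverse (C : H →L[ℂ] H) (hC : Function.Injective C) : H →ₗ.[ℂ] H where
  domain := LinearMap.range (C : H →ₗ[ℂ] H)
  toFun := (LinearEquiv.ofInjective (C : H →ₗ[ℂ] H) hC).symm.toLinearMap

theorem ofInjectiveInverse_apply (C : H →L[ℂ] H) (hC : Function.Injective C)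
    (x : (ofInjectiveInverse C hC).domain) : C (ofInjectiveInverse C hC x) = x :=
  congrArg Subtype.val ((LinearEquiv.ofInjective (C : H →ₗ[ℂ] H) hC).apply_symm_apply x)

theorem ofInjectiveInverse_map (C : H →L[ℂ] H) (hC : Function.Injective C) (z : H)
    (h : C z ∈ (ofInjectiveInverse C hC).domain) : ofInjectiveInverse C hC ⟨C z, h⟩ = z :=
  hC (ofInjectiveInverse_apply C hC ⟨C z, h⟩)

end LinearPMap

section

open LinearPMap

variable {H : Type*} [NormedAddCommGroup H] [InnerProductSpace ℂ H] [CompleteSpace H]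

theorem ContinuousLinearMap.IsPositive.isNonnegSelfAdjoint_toPMap {A : H →L[ℂ] H}
    (hA : A.IsPositive) : IsNonnegSelfAdjoint ((A : H →ₗ[ℂ] H).toPMap ⊤) := by
  refine ⟨by simp, ?_, fun x => hA.inner_nonneg_left x⟩
  rw [A.toPMap_adjoint_eq_adjoint_toPMap_of_dense (by simp), hA.isSelfAdjoint.adjoint_eq]

/-- The inverse of an injective bounded positive operator is nonnegative selfadjoint. -/
theorem ContinuousLinearMap.IsPositive.isNonnegSelfAdjoint_inverse {C : H →L[ℂ] H}
    (hC : C.IsPositive) (hinj : Function.Injective C) :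
    IsNonnegSelfAdjoint (ofInjectiveInverse C hinj) := by
  have hsymm := hC.inner_left_eq_inner_right
  have hd : Dense ((ofInjectiveInverse C hinj).domain : Set H) := by
    rw [Submodule.dense_iff_topologicalClosure_eq_top, Submodule.topologicalClosure_eq_top_iff,
      Submodule.eq_bot_iff]
    intro y hy
    refine (injective_iff_map_eq_zero C).1 hinj y ?_
    refine ext_inner_left ℂ fun z => ?_
    rw [← hsymm, inner_zero_right]
    exact hy _ ⟨z, rfl⟩
  have hadj : (ofInjectiveInverse C hinj).IsFormalAdjoint (ofInjectiveInverse C hinj) := by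
    rintro ⟨_, z, rfl⟩ ⟨_, w, rfl⟩
    erw [ofInjectiveInverse_map, ofInjectiveInverse_map]
    exact (hsymm z w).symm
  have hle : (ofInjectiveInverse C hinj).adjoint.domain ≤ (ofInjectiveInverse C hinj).domain := by
    intro y hy
    refine ⟨(ofInjectiveInverse C hinj).adjoint ⟨y, hy⟩, ext_inner_right ℂ fun v => ?_⟩
    have h := adjoint_isFormalAdjoint hd ⟨y, hy⟩ ⟨C v, v, rfl⟩
    erw [ofInjectiveInverse_map] at h
    exact (hsymm _ v).trans h
  refine ⟨hd, (eq_of_le_of_domain_eq (hadj.le_adjoint hd)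
    (le_antisymm (hadj.le_adjoint hd).1 hle)).symm, ?_⟩
  · rintro ⟨_, z, rfl⟩
    erw [ofInjectiveInverse_map]
    exact hC.inner_nonneg_right z

namespace IsNonnegSelfAdjoint

variable {S : H →ₗ.[ℂ] H}

theorem isFormalAdjoint_s16 (hS : IsNonnegSelfAdjoint S) : S.IsFormalAdjoint S := by
  have := adjoint_isFormalAdjoint hS.1
  rwa [hS.2.1] at this

theorem norm_sq_add_le (hS : IsNonnegSelfAdjoint S) (x : S.domain) :
    ‖(x : H)‖ ^ 2 + ‖S x‖ ^ 2 ≤ ‖(x : H) + S x‖ ^ 2 := by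
  rw [add_comm (x : H), @norm_add_sq ℂ]
  have := (Complex.nonneg_iff.1 (hS.2.2 x)).1
  simp only [RCLike.re_to_complex]
  linarith

/-- `1 + S` maps `dom S` onto `H`. -/
theorem exists_add_eq (hS : IsNonnegSelfAdjoint S) (z : H) :
    ∃ x : S.domain, (x : H) + S x = z := by
  let f : S.graph →L[ℂ] H :=
    (ContinuousLinearMap.fst ℂ H H + ContinuousLinearMap.snd ℂ H H) ∘L S.graph.subtypeL
  have hclosed : _root_.IsClosed (S.graph : Set (H × H)) :=
    IsSelfAdjoint.isClosed (A := S) hS.2.1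
  have : CompleteSpace S.graph := hclosed.completeSpace_coe
  have hf : AntilipschitzWith 1 f := f.antilipschitz_of_bound fun p => by
    obtain ⟨⟨a, b⟩, hp⟩ := p
    obtain ⟨x, rfl, rfl⟩ := S.mem_graph_iff.1 hp
    have h := hS.norm_sq_add_le x
    rw [NNReal.coe_one, one_mul]
    change max ‖(x : H)‖ ‖S x‖ ≤ ‖(x : H) + S x‖
    exact max_le (le_of_sq_le_sq (by linarith [sq_nonneg ‖S x‖]) (norm_nonneg _))
      (le_of_sq_le_sq (by linarith [sq_nonneg ‖(x : H)‖]) (norm_nonneg _))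
  have hr : _root_.IsClosed (LinearMap.range (f : S.graph →ₗ[ℂ] H) : Set H) :=
    hf.isClosed_range f.uniformContinuous
  have htop : LinearMap.range (f : S.graph →ₗ[ℂ] H) = ⊤ := by
    rw [← hr.submodule_topologicalClosure_eq, Submodule.topologicalClosure_eq_top_iff,
      Submodule.eq_bot_iff]
    intro y hy
    have hy' (x : S.domain) : inner ℂ (-y) (x : H) = inner ℂ y (S x) := by
      have : inner ℂ ((x : H) + S x) y = 0 := hy _ ⟨⟨(x, S x), S.mem_graph x⟩, rfl⟩
      rw [inner_eq_zero_symm, inner_add_right] at this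
      rw [inner_neg_left]
      linear_combination -this
    have hmem : y ∈ S.adjoint.domain := mem_adjoint_domain_of_exists y ⟨-y, hy'⟩
    have happ : S.adjoint ⟨y, hmem⟩ = -y := adjoint_apply_eq hS.1 _ hy'
    have hpos : ∀ x : S.adjoint.domain, 0 ≤ inner ℂ (S.adjoint x) (x : H) := by
      rw [hS.2.1]
      exact hS.2.2
    have h := (Complex.nonneg_iff.1 (hpos ⟨y, hmem⟩)).1
    rw [happ, inner_neg_left, Complex.neg_re] at h
    have h2 : (inner ℂ y y).re = ‖y‖ ^ 2 := inner_self_eq_norm_sq (𝕜 := ℂ) y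
    have h3 : ‖y‖ = 0 := by nlinarith [sq_nonneg ‖y‖]
    exact norm_eq_zero.1 h3
  obtain ⟨⟨⟨a, b⟩, hp⟩, h⟩ := LinearMap.range_eq_top.1 htop z
  obtain ⟨x, rfl, rfl⟩ := S.mem_graph_iff.1 hp
  exact ⟨x, h⟩

theorem eq_of_add_eq (hS : IsNonnegSelfAdjoint S) {x y : S.domain}
    (h : (x : H) + S x = y + S y) : x = y := by
  have hn := hS.norm_sq_add_le (x - y)
  have h0 : ((x - y : S.domain) : H) + S (x - y) = 0 := by
    rw [S.map_sub, Submodule.coe_sub, sub_add_sub_comm, h, sub_self]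
  rw [h0, norm_zero] at hn
  have : ‖((x - y : S.domain) : H)‖ = 0 := by
    nlinarith [sq_nonneg ‖S (x - y)‖, sq_nonneg ‖((x - y : S.domain) : H)‖]
  exact sub_eq_zero.1 (Subtype.ext (norm_eq_zero.1 this))

/-- The resolvent `(1 + S)⁻¹` is a bounded operator. -/
theorem exists_resolvent (hS : IsNonnegSelfAdjoint S) :
    ∃ R : H →L[ℂ] H, ∀ z, ∃ h : R z ∈ S.domain, R z + S ⟨R z, h⟩ = z := by
  choose r hr using hS.exists_add_eq
  let L : H →ₗ[ℂ] H :=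
    { toFun z := r z
      map_add' z w := by
        rw [← Submodule.coe_add]
        refine congrArg Subtype.val (hS.eq_of_add_eq ?_)
        rw [hr, S.map_add, Submodule.coe_add, add_add_add_comm, hr, hr]
      map_smul' c z := by
        rw [RingHom.id_apply, ← Submodule.coe_smul]
        refine congrArg Subtype.val (hS.eq_of_add_eq ?_)
        rw [hr, S.map_smul, Submodule.coe_smul, ← smul_add, hr] }
  refine ⟨L.mkContinuous 1 fun z => ?_, fun z => ⟨(r z).2, hr z⟩⟩
  have h := hS.norm_sq_add_le (r z)
  rw [hr] at h
  rw [one_mul]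
  exact le_of_sq_le_sq (by dsimp [L]; nlinarith [sq_nonneg ‖S (r z)‖]) (norm_nonneg _)

variable {R : H →L[ℂ] H}

theorem resolvent_add (hS : IsNonnegSelfAdjoint S)
    (hR : ∀ z, ∃ h : R z ∈ S.domain, R z + S ⟨R z, h⟩ = z) (x : S.domain) :
    R (x + S x) = x := by
  obtain ⟨h, hx⟩ := hR (x + S x)
  exact congrArg Subtype.val (hS.eq_of_add_eq (x := ⟨_, h⟩) hx)

theorem resolvent_isPositive (hS : IsNonnegSelfAdjoint S)
    (hR : ∀ z, ∃ h : R z ∈ S.domain, R z + S ⟨R z, h⟩ = z) : R.IsPositive := by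
  refine (R.isPositive_iff).2 ⟨fun z w => ?_, fun z => ?_⟩
  · obtain ⟨hz, ez⟩ := hR z
    obtain ⟨hw, ew⟩ := hR w
    have h := hS.isFormalAdjoint_s16 ⟨_, hz⟩ ⟨_, hw⟩
    change inner ℂ (R z) w = inner ℂ z (R w)
    nth_rewrite 2 [← ez]
    nth_rewrite 1 [← ew]
    rw [inner_add_left, inner_add_right, h]
  · obtain ⟨hz, ez⟩ := hR z
    nth_rewrite 2 [← ez]
    rw [inner_add_right, ← hS.isFormalAdjoint_s16 ⟨_, hz⟩ ⟨_, hz⟩]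
    exact add_nonneg (ContinuousLinearMap.isPositive_one.inner_nonneg_left _) (hS.2.2 ⟨_, hz⟩)

theorem one_sub_resolvent_isPositive (hS : IsNonnegSelfAdjoint S)
    (hR : ∀ z, ∃ h : R z ∈ S.domain, R z + S ⟨R z, h⟩ = z) : (1 - R).IsPositive := by
  refine ((1 - R).isPositive_iff).2 ⟨?_, fun z => ?_⟩
  · exact LinearMap.IsSymmetric.id.sub (hS.resolvent_isPositive hR).isSymmetric
  · obtain ⟨hz, ez⟩ := hR z
    have e : (1 - R) z = S ⟨_, hz⟩ := by
      rw [_root_.sub_apply, one_apply_eq_self, sub_eq_iff_eq_add', ez]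
    rw [e]
    nth_rewrite 2 [← ez]
    rw [inner_add_right]
    exact add_nonneg (hS.2.2 ⟨_, hz⟩)
      (ContinuousLinearMap.isPositive_one.inner_nonneg_left _)

theorem eq_zero_of_inner_resolvent (hS : IsNonnegSelfAdjoint S)
    (hR : ∀ z, ∃ h : R z ∈ S.domain, R z + S ⟨R z, h⟩ = z) (z : H)
    (h : inner ℂ (R z) z = 0) : z = 0 := by
  obtain ⟨hz, ez⟩ := hR z
  have h1 : inner ℂ (R z) (R z) + inner ℂ (S ⟨_, hz⟩) (R z) = 0 := by
    rw [hS.isFormalAdjoint_s16 ⟨_, hz⟩ ⟨_, hz⟩, ← inner_add_right, ez, h]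
  have h0 : R z = 0 := by
    rw [← inner_self_eq_zero (𝕜 := ℂ)]
    have hnn : 0 ≤ inner ℂ (R z) (R z) :=
      ContinuousLinearMap.isPositive_one.inner_nonneg_left (R z)
    have hiff := add_eq_zero_iff_of_nonneg hnn (hS.2.2 ⟨_, hz⟩)
    exact (hiff.1 h1).1
  have h2 : (⟨R z, hz⟩ : S.domain) = 0 := Subtype.ext h0
  rw [← ez, h2, S.map_zero, h0, add_zero]

end IsNonnegSelfAdjoint

end

/-- if a closed densely defined `T` is quasi-similar to a nonnegative selfadjoint
`S`, then `T` is squeezed between a product from `L²₊` and a product from `L²₋`: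
`A₁ ∘ B₁ ⊆ T ⊆ W⁻¹ ∘ A₂`. -/
theorem statement16
    {H : Type*} [NormedAddCommGroup H] [InnerProductSpace ℂ H] [CompleteSpace H]
    (T : H →ₗ.[ℂ] H) (hT : T.IsClosed) (hTd : Dense (T.domain : Set H))
    (S : H →ₗ.[ℂ] H) (hS : IsNonnegSelfAdjoint S)
    (hqs : ∃ G₁ G₂ : H →L[ℂ] H, IsQuasiAffinity G₁ ∧ IsQuasiAffinity G₂ ∧
      (∀ x : T.domain, ∃ h : G₁ (x : H) ∈ S.domain, S ⟨G₁ (x : H), h⟩ = G₁ (T x)) ∧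
      (∀ x : S.domain, ∃ h : G₂ (x : H) ∈ T.domain, T ⟨G₂ (x : H), h⟩ = G₂ (S x))) :
    (∃ (A₁ : H →L[ℂ] H) (B₁ : H →ₗ.[ℂ] H), A₁.IsPositive ∧ IsNonnegSelfAdjoint B₁ ∧
      ∃ h : B₁.domain ≤ T.domain, ∀ x : B₁.domain, T ⟨(x : H), h x.2⟩ = A₁ (B₁ x)) ∧
    (∃ (W : H →L[ℂ] H) (A₂ : H →ₗ.[ℂ] H), W.IsPositive ∧ Function.Injective W ∧
      IsNonnegSelfAdjoint A₂ ∧ ∃ h : T.domain ≤ A₂.domain,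
        ∀ x : T.domain, W (T x) = A₂ ⟨(x : H), h x.2⟩) := by
  obtain ⟨G₁, G₂, hG₁, hG₂, h₁, h₂⟩ := hqs
  obtain ⟨R, hR⟩ := hS.exists_resolvent
  have hpos := hS.resolvent_isPositive hR
  have hpos' := hS.one_sub_resolvent_isPositive hR
  have hinj := hS.eq_zero_of_inner_resolvent hR
  have hG₂' : Function.Injective (ContinuousLinearMap.adjoint G₂) := by
    rw [injective_iff_map_eq_zero]
    intro y hy
    refine hG₂.2.eq_zero_of_inner_left ℂ ?_
    intro x
    rw [← ContinuousLinearMap.adjoint_inner_left, hy, inner_zero_left]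
  constructor
  · have hC := hpos.conj_adjoint G₂
    have hCinj : Function.Injective (G₂ ∘L R ∘L ContinuousLinearMap.adjoint G₂) := by
      simpa using injective_adjoint_conj hinj hG₂'
    have key (z : H) : ∃ h : (G₂ ∘L R ∘L ContinuousLinearMap.adjoint G₂) z ∈ T.domain,
        T ⟨_, h⟩ = (G₂ ∘L (1 - R) ∘L ContinuousLinearMap.adjoint G₂) z := by
      obtain ⟨hz, ez⟩ := hR (ContinuousLinearMap.adjoint G₂ z)
      obtain ⟨h, e⟩ := h₂ ⟨_, hz⟩
      refine ⟨h, e.trans (congrArg G₂ ?_)⟩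
      exact eq_sub_of_add_eq' ez
    refine ⟨G₂ ∘L (1 - R) ∘L ContinuousLinearMap.adjoint G₂,
      LinearPMap.ofInjectiveInverse _ hCinj, hpos'.conj_adjoint G₂,
      hC.isNonnegSelfAdjoint_inverse hCinj, ?_, ?_⟩
    · rintro _ ⟨z, rfl⟩
      exact (key z).1
    · rintro ⟨_, z, rfl⟩
      exact (key z).2.trans (congrArg _ (LinearPMap.ofInjectiveInverse_map _ hCinj z _).symm)
  · refine ⟨ContinuousLinearMap.adjoint G₁ ∘L R ∘L G₁,
      ((ContinuousLinearMap.adjoint G₁ ∘L (1 - R) ∘L G₁ : H →L[ℂ] H) : H →ₗ[ℂ] H).toPMap ⊤,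
      hpos.adjoint_conj G₁, injective_adjoint_conj hinj hG₁.1,
      (hpos'.adjoint_conj G₁).isNonnegSelfAdjoint_toPMap, le_top, fun x => ?_⟩
    obtain ⟨h, e⟩ := h₁ x
    have hx := hS.resolvent_add hR ⟨_, h⟩
    rw [map_add, e] at hx
    exact congrArg (ContinuousLinearMap.adjoint G₁) (eq_sub_of_add_eq' hx)
end
end

section
/- Let T be a densely defined operator on H. Then the following are equivalent: (a) T is quasi-affine to some S ∈ L⁺(H), i.e. there exist S ∈ L⁺(H) and a quasi-affinity G with G(Tx) = S(Gx) for all x ∈ dom T; (b) there exist a quasi-affinity G and S ∈ L⁺(H) such that ran G* ⊆ dom T* and T*(G*y) = G*(Sy) for all y ∈ H (equivalently, (G⁻¹)*∘T*∘G* is an everywhere defined operator equal to S ∈ L⁺(H), and then S = closure(G∘T∘G⁻¹)). Moreover, in this case: there exist a quasi-affinity W ∈ L⁺(H) and A ∈ L⁺(H) with W(Tx) = Ax for all x ∈ dom T (so T ⊆ W⁻¹∘A, a product B∘A with A, B⁻¹ ∈ L⁺(H)); and there exist a quasi-affinity X ∈ L⁺(H) and C ∈ L⁺(H) with ran X ⊆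 dom T*, T*(Xy) = Cy for all y ∈ H, and X(Tx) = Cx for all x ∈ dom T (i.e. T*∘X = closure(X∘T) = C ∈ L⁺(H)). -/
open scoped ComplexOrder
noncomputable section

local notation "⟪" x ", " y "⟫" => @inner ℂ _ _ x y

/-- `G* ∘ G` is a quasi-affinity whenever `G` is injective. -/
theorem isQuasiAffinity_adjoint_comp_self
    {H : Type*} [NormedAddCommGroup H] [InnerProductSpace ℂ H] [CompleteSpace H]
    {G : H →L[ℂ] H} (hG : Function.Injective G) :
    IsQuasiAffinity (ContinuousLinearMap.adjoint G ∘L G) := by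
  have hker : (ContinuousLinearMap.adjoint G ∘L G).ker = ⊥ := by
    rw [ContinuousLinearMap.ker_adjoint_comp_self]
    exact LinearMap.ker_eq_bot.mpr hG
  refine ⟨LinearMap.ker_eq_bot.mp hker, ?_⟩
  have h := ContinuousLinearMap.orthogonal_ker (ContinuousLinearMap.adjoint G ∘L G)
  rw [hker, Submodule.bot_orthogonal_eq_top,
    (ContinuousLinearMap.isPositive_adjoint_comp_self G).isSelfAdjoint.adjoint_eq] at h
  exact Submodule.dense_iff_topologicalClosure_eq_top.mpr h.symm

/-- The bounded identities `G ∘ T ⊆ K` and `T* ∘ G* = K*` are equivalent. -/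
theorem comp_eq_iff_adjoint_comp_eq
    {H : Type*} [NormedAddCommGroup H] [InnerProductSpace ℂ H] [CompleteSpace H]
    {T : H →ₗ.[ℂ] H} (hT : Dense (T.domain : Set H)) (G K : H →L[ℂ] H) :
    (∀ x : T.domain, G (T x) = K (x : H)) ↔
      ∃ h : ∀ y : H, ContinuousLinearMap.adjoint G y ∈ T.adjoint.domain,
        ∀ y : H, T.adjoint ⟨ContinuousLinearMap.adjoint G y, h y⟩
          = ContinuousLinearMap.adjoint K y := by
  constructor
  · intro h
    have key (y : H) (x : T.domain) : ⟪ContinuousLinearMap.adjoint K y, (x : H)⟫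
        = ⟪ContinuousLinearMap.adjoint G y, T x⟫ := by
      rw [ContinuousLinearMap.adjoint_inner_left, ContinuousLinearMap.adjoint_inner_left, h]
    exact ⟨fun y => T.mem_adjoint_domain_of_exists _ ⟨_, key y⟩,
      fun y => LinearPMap.adjoint_apply_eq hT _ (key y)⟩
  · rintro ⟨h, hK⟩ x
    refine ext_inner_left ℂ fun y => ?_
    have := LinearPMap.adjoint_isFormalAdjoint hT ⟨_, h y⟩ x
    rw [hK] at this
    rw [← ContinuousLinearMap.adjoint_inner_left, ← ContinuousLinearMap.adjoint_inner_left, this]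

/-- for a densely defined `T` on `H`, quasi-affinity of `T` to some `S ∈ L⁺(H)`
is equivalent to `ran G* ⊆ dom T*` with `T* ∘ G* = G* ∘ S`; and in this case `T ⊆ W⁻¹ ∘ A`
with `W, A ∈ L⁺(H)`, `W` a quasi-affinity, and `T* ∘ X = closure (X ∘ T) = C ∈ L⁺(H)` for a
quasi-affinity `X ∈ L⁺(H)`. -/
theorem statement17
    {H : Type*} [NormedAddCommGroup H] [InnerProductSpace ℂ H] [CompleteSpace H]
    (T : H →ₗ.[ℂ] H) (hTd : Dense (T.domain : Set H)) :
    ((∃ (S G : H →L[ℂ] H), S.IsPositive ∧ IsQuasiAffinity G ∧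
        ∀ x : T.domain, G (T x) = S (G (x : H))) ↔
      (∃ (G S : H →L[ℂ] H), IsQuasiAffinity G ∧ S.IsPositive ∧
        ∃ h : ∀ y : H, ContinuousLinearMap.adjoint G y ∈ T.adjoint.domain,
          ∀ y : H, T.adjoint ⟨ContinuousLinearMap.adjoint G y, h y⟩
            = ContinuousLinearMap.adjoint G (S y))) ∧
    ((∃ (S G : H →L[ℂ] H), S.IsPositive ∧ IsQuasiAffinity G ∧
        ∀ x : T.domain, G (T x) = S (G (x : H))) →
      ((∃ (W A : H →L[ℂ] H), IsQuasiAffinity W ∧ W.IsPositive ∧ A.IsPositive ∧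
          ∀ x : T.domain, W (T x) = A (x : H)) ∧
       (∃ (X C : H →L[ℂ] H), IsQuasiAffinity X ∧ X.IsPositive ∧ C.IsPositive ∧
          (∃ h : ∀ y : H, X y ∈ T.adjoint.domain,
            ∀ y : H, T.adjoint ⟨X y, h y⟩ = C y) ∧
          ∀ x : T.domain, X (T x) = C (x : H)))) := by
  have adjoint_comp {S : H →L[ℂ] H} (hS : S.IsPositive) (G : H →L[ℂ] H) (y : H) :
      ContinuousLinearMap.adjoint (S ∘L G) y = ContinuousLinearMap.adjoint G (S y) := by
    rw [ContinuousLinearMap.adjoint_comp, hS.isSelfAdjoint.adjoint_eq,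
      ContinuousLinearMap.comp_apply]
  refine ⟨⟨?_, ?_⟩, ?_⟩
  · rintro ⟨S, G, hS, hG, h⟩
    obtain ⟨hd, hd'⟩ := (comp_eq_iff_adjoint_comp_eq hTd G (S ∘L G)).mp h
    exact ⟨G, S, hG, hS, hd, fun y => (hd' y).trans (adjoint_comp hS G y)⟩
  · rintro ⟨G, S, hG, hS, hd, hd'⟩
    exact ⟨S, G, hS, hG, (comp_eq_iff_adjoint_comp_eq hTd G (S ∘L G)).mpr
      ⟨hd, fun y => (hd' y).trans (adjoint_comp hS G y).symm⟩⟩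
  · rintro ⟨S, G, hS, hG, h⟩
    set X := ContinuousLinearMap.adjoint G ∘L G with hX
    set C := ContinuousLinearMap.adjoint G ∘L S ∘L G with hC
    have hXq : IsQuasiAffinity X := isQuasiAffinity_adjoint_comp_self hG.1
    have hXp : X.IsPositive := ContinuousLinearMap.isPositive_adjoint_comp_self G
    have hCp : C.IsPositive := hS.adjoint_conj G
    have hXT (x : T.domain) : X (T x) = C (x : H) := by
      simp [hX, hC, h]
    have hTX := (comp_eq_iff_adjoint_comp_eq hTd X C).mp hXT
    simp only [hXp.isSelfAdjoint.adjoint_eq, hCp.isSelfAdjoint.adjoint_eq] at hTX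
    exact ⟨⟨X, C, hXq, hXp, hCp, hXT⟩, ⟨X, C, hXq, hXp, hCp, hTX, hXT⟩⟩
end
end

section
/- Let T be a closed densely defined operator on H and suppose T is G-quasi-affine to some S ∈ L⁺(H), i.e. G is a quasi-affinity with G(Tx) = S(Gx) for all x ∈ dom T. Then the reversed Sebestyén inequality T*T ≥ (1/λ)·closure(A∘T) holds for a suitable A ∈ L⁺(H): concretely, setting A := G*∘S∘G ∈ L⁺(H), C := G*∘S²∘G ∈ L⁺(H) and λ := ‖G‖², one has A(Tx) = Cx and 0 ≤ ⟨Cx, x⟩ ≤ λ·‖Tx‖² for all x ∈ dom T (so closure(A∘T) = C is a bounded nonnegative operator whose quadratic form is dominated by λ times that of T*T). -/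
open scoped ComplexOrder
noncomputable section

local notation "⟪" x ", " y "⟫" => @inner ℂ _ _ x y

/-- if a closed densely defined `T` is `G`-quasi-affine to `S ∈ L⁺(H)`, then the
reversed Sebestyén inequality holds with `A = G* S G`, `C = closure (A ∘ T) = G* S² G ∈ L⁺(H)`
and `λ = ‖G‖²`: on `dom T` one has `A (T x) = C x` and `0 ≤ ⟪C x, x⟫ ≤ λ ‖T x‖²`. -/
theorem statement18
    {H : Type*} [NormedAddCommGroup H] [InnerProductSpace ℂ H] [CompleteSpace H]
    (T : H →ₗ.[ℂ] H) (hT : T.IsClosed) (hTd : Dense (T.domain : Set H))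
    (G S : H →L[ℂ] H) (hS : S.IsPositive) (hG : IsQuasiAffinity G)
    (hqa : ∀ x : T.domain, G (T x) = S (G (x : H)))
    (A C : H →L[ℂ] H)
    (hA : A = (ContinuousLinearMap.adjoint G).comp (S.comp G))
    (hC : C = (ContinuousLinearMap.adjoint G).comp ((S.comp S).comp G)) :
    A.IsPositive ∧ C.IsPositive ∧
    ∀ x : T.domain,
      A (T x) = C (x : H) ∧
      0 ≤ ⟪C (x : H), (x : H)⟫ ∧
      (⟪C (x : H), (x : H)⟫).re ≤ ‖G‖ ^ 2 * ‖T x‖ ^ 2 := by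
  have hSadj : ContinuousLinearMap.adjoint S = S := hS.isSelfAdjoint.adjoint_eq
  have hCsq : C = (ContinuousLinearMap.adjoint (S.comp G)).comp (S.comp G) := by
    rw [hC, ContinuousLinearMap.adjoint_comp, hSadj]
    rfl
  have hCpos : C.IsPositive := by
    rw [hCsq]
    exact ContinuousLinearMap.isPositive_adjoint_comp_self _
  refine ⟨hA ▸ hS.adjoint_conj G, hCpos, fun x => ⟨?_, hCpos.inner_nonneg_left x, ?_⟩⟩
  · simp [hA, hC, hqa x]
  · have hinner : (⟪C (x : H), (x : H)⟫).re = ‖G (T x)‖ ^ 2 := by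
      rw [hqa x, hCsq, ContinuousLinearMap.comp_apply, ContinuousLinearMap.adjoint_inner_left]
      exact inner_self_eq_norm_sq (𝕜 := ℂ) _
    rw [hinner, ← mul_pow]
    gcongr
    exact G.le_opNorm _
end
end

section
/- Let T = A∘B be a closed operator on H, where A ∈ L⁺(H) is injective (equivalently, has dense range) and B is nonnegative selfadjoint (so T ∈ L²₊ with dom T = dom B). Then A^{1/2} is a quasi-affinity, the operator S := A^{1/2}∘B∘A^{1/2} (domain {x : A^{1/2}x ∈ dom B}) is nonnegative selfadjoint, and T* is A^{1/2}-quasi-affine to S: for every y ∈ dom T*, A^{1/2}y ∈ dom S and S(A^{1/2}y) = A^{1/2}(T*y). -/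
open scoped ComplexOrder
noncomputable section

local notation "⟪" x ", " y "⟫" => @inner ℂ _ _ x y

theorem mem_graph_pcomp_iff {R E F G : Type*} [CommRing R] [AddCommGroup E] [Module R E]
    [AddCommGroup F] [Module R F] [AddCommGroup G] [Module R G]
    (S : F →ₗ.[R] G) (T : E →ₗ.[R] F) (x : E) (z : G) :
    (x, z) ∈ (pcomp S T).graph ↔ ∃ y, (x, y) ∈ T.graph ∧ (y, z) ∈ S.graph := by
  have key : ∀ (w : T.domain) (hw : T w ∈ S.domain) (hw' : (w : E) ∈ (pcomp S T).domain),
      pcomp S T ⟨w, hw'⟩ = S ⟨T w, hw⟩ := by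
    intro w hw hw'
    have h : (Submodule.equivMapOfInjective T.domain.subtype (Submodule.injective_subtype _)
        (S.domain.comap T.toFun)).symm ⟨w, hw'⟩ = ⟨w, hw⟩ := by
      rw [LinearEquiv.symm_apply_eq]
      rfl
    change S (T.toFun.restrict _ ((Submodule.equivMapOfInjective T.domain.subtype
      (Submodule.injective_subtype _) (S.domain.comap T.toFun)).symm ⟨w, hw'⟩)) = _
    rw [h]
    rfl
  rw [LinearPMap.mem_graph_iff]
  constructor
  · rintro ⟨⟨_, hx⟩, rfl, rfl⟩
    obtain ⟨w, hw, rfl⟩ := id hx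
    exact ⟨T w, T.mem_graph w, by
      rw [show pcomp S T ⟨T.domain.subtype w, hx⟩ = _ from key w hw hx]
      exact S.mem_graph ⟨T w, hw⟩⟩
  · rintro ⟨y, h₁, h₂⟩
    obtain ⟨w, rfl, rfl⟩ := (LinearPMap.mem_graph_iff T).1 h₁
    have hv : T w ∈ S.domain := LinearPMap.mem_domain_of_mem_graph h₂
    exact ⟨⟨w, w, hv, rfl⟩, rfl,
      (key w hv _).trans ((LinearPMap.image_iff hv).2 h₂).symm⟩

section ClosedOperators

variable {E F : Type*} [NormedAddCommGroup E] [InnerProductSpace ℂ E]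
  [NormedAddCommGroup F] [InnerProductSpace ℂ F]

theorem mem_graph_ofCLM_iff (X : E →L[ℂ] F) (x : E) (y : F) :
    (x, y) ∈ (ofCLM X).graph ↔ X x = y := by
  rw [LinearPMap.mem_graph_iff]
  exact ⟨by rintro ⟨w, rfl, rfl⟩; rfl, fun h => ⟨⟨x, Submodule.mem_top⟩, rfl, h⟩⟩

theorem mem_graph_ofCLM_pcomp_iff {G : Type*} [AddCommGroup G] [Module ℂ G] (X : E →L[ℂ] F)
    (T : G →ₗ.[ℂ] E) (x : G) (z : F) :
    (x, z) ∈ (pcomp (ofCLM X) T).graph ↔ ∃ y, (x, y) ∈ T.graph ∧ X y = z := by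
  simp only [mem_graph_pcomp_iff, mem_graph_ofCLM_iff]

theorem mem_graph_pcomp_ofCLM_iff_s19 {G : Type*} [AddCommGroup G] [Module ℂ G] (X : E →L[ℂ] F)
    (T : F →ₗ.[ℂ] G) (x : E) (z : G) :
    (x, z) ∈ (pcomp T (ofCLM X)).graph ↔ (X x, z) ∈ T.graph := by
  simp only [mem_graph_pcomp_iff, mem_graph_ofCLM_iff, exists_eq_left']

theorem domain_ofCLM_pcomp {G : Type*} [AddCommGroup G] [Module ℂ G] (X : E →L[ℂ] F)
    (T : G →ₗ.[ℂ] E) : (pcomp (ofCLM X) T).domain = T.domain := by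
  ext x
  simp only [LinearPMap.mem_domain_iff, mem_graph_ofCLM_pcomp_iff]
  exact ⟨fun ⟨_, y, h, _⟩ => ⟨y, h⟩, fun ⟨y, h⟩ => ⟨_, y, h, rfl⟩⟩

/-- If `Y ∘ X ∘ T` is closed for bounded `X`, `Y` with `Y` injective, then so is `X ∘ T`. -/
theorem isClosed_ofCLM_pcomp_of_comp {G K : Type*} [NormedAddCommGroup G] [InnerProductSpace ℂ G]
    [NormedAddCommGroup K] [InnerProductSpace ℂ K] {T : G →ₗ.[ℂ] E} {X : E →L[ℂ] F}
    {Y : F →L[ℂ] K} (hY : Function.Injective Y) (h : (pcomp (ofCLM (Y.comp X)) T).IsClosed) :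
    (pcomp (ofCLM X) T).IsClosed := by
  have hpre : ((pcomp (ofCLM X) T).graph : Set (G × F)) =
      (fun p : G × F => (p.1, Y p.2)) ⁻¹' (pcomp (ofCLM (Y.comp X)) T).graph := by
    ext ⟨x, z⟩
    simp only [Set.mem_preimage, SetLike.mem_coe, mem_graph_ofCLM_pcomp_iff,
      ContinuousLinearMap.comp_apply, hY.eq_iff]
  rw [LinearPMap.IsClosed, hpre]
  exact IsClosed.preimage (by fun_prop) h

theorem Submodule.adjoint_adjoint_le_of_isClosed [CompleteSpace E] [CompleteSpace F]
    {g : Submodule ℂ (E × F)} (hg : IsClosed (g : Set (E × F))) : g.adjoint.adjoint ≤ g := by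
  rintro ⟨u, v⟩ huv
  rw [Submodule.mem_adjoint_iff] at huv
  let K : Submodule ℂ (WithLp 2 (E × F)) :=
    g.comap (WithLp.linearEquiv 2 ℂ (E × F)).toLinearMap
  have hK : IsClosed (K : Set (WithLp 2 (E × F))) :=
    hg.preimage (WithLp.prod_continuous_ofLp 2 E F)
  have hKK : Kᗮᗮ = K := by
    rw [Submodule.orthogonal_orthogonal_eq_closure, hK.submodule_topologicalClosure_eq]
  suffices h : WithLp.toLp 2 (u, v) ∈ Kᗮᗮ by
    rw [hKK] at h
    exact h
  intro w hw
  have hw' : (w.snd, -w.fst) ∈ g.adjoint := by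
    rw [Submodule.mem_adjoint_iff]
    intro a b hab
    have := hw (WithLp.toLp 2 (a, b)) hab
    rw [WithLp.prod_inner_apply] at this
    simpa [add_comm] using this
  have := huv _ _ hw'
  rw [WithLp.prod_inner_apply]
  rw [inner_neg_left] at this
  change inner ℂ w.fst u + inner ℂ w.snd v = 0
  linear_combination -this

variable [CompleteSpace E]

theorem LinearPMap.mem_graph_adjoint_iff_s19 {T : E →ₗ.[ℂ] F} (hT : Dense (T.domain : Set E))
    (y : F) (z : E) :
    (y, z) ∈ T.adjoint.graph ↔ ∀ a b, (a, b) ∈ T.graph → inner ℂ b y = inner ℂ a z := by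
  simp only [adjoint_graph_eq_graph_adjoint hT, Submodule.mem_adjoint_iff, sub_eq_zero]

theorem LinearPMap.IsClosed.dense_adjoint_domain [CompleteSpace F] {T : E →ₗ.[ℂ] F}
    (hc : T.IsClosed) (hT : Dense (T.domain : Set E)) : Dense (T.adjoint.domain : Set F) := by
  rw [Submodule.dense_iff_topologicalClosure_eq_top, Submodule.topologicalClosure_eq_top_iff,
    Submodule.eq_bot_iff]
  intro v hv
  refine T.graph_fst_eq_zero_snd (Submodule.adjoint_adjoint_le_of_isClosed hc ?_) rfl
  rw [Submodule.mem_adjoint_iff, ← adjoint_graph_eq_graph_adjoint hT]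
  intro a b hab
  simpa using hv a (mem_domain_of_mem_graph hab)

theorem LinearPMap.IsClosed.adjoint_adjoint [CompleteSpace F] {T : E →ₗ.[ℂ] F}
    (hc : T.IsClosed) (hT : Dense (T.domain : Set E)) : T.adjoint.adjoint = T := by
  refine le_antisymm (le_of_le_graph ?_) ?_
  · rw [adjoint_graph_eq_graph_adjoint (hc.dense_adjoint_domain hT),
      adjoint_graph_eq_graph_adjoint hT]
    exact Submodule.adjoint_adjoint_le_of_isClosed hc
  · exact (adjoint_isFormalAdjoint hT).le_adjoint (hc.dense_adjoint_domain hT)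

theorem adjoint_ofCLM_pcomp {G : Type*} [NormedAddCommGroup G] [InnerProductSpace ℂ G]
    [CompleteSpace G] [CompleteSpace F] {T : G →ₗ.[ℂ] E} (hT : Dense (T.domain : Set G))
    (X : E →L[ℂ] F) :
    (pcomp (ofCLM X) T).adjoint = pcomp T.adjoint (ofCLM X.adjoint) := by
  refine LinearPMap.eq_of_eq_graph ?_
  ext ⟨y, z⟩
  rw [LinearPMap.mem_graph_adjoint_iff_s19 (by rwa [domain_ofCLM_pcomp]), mem_graph_pcomp_ofCLM_iff_s19,
    LinearPMap.mem_graph_adjoint_iff_s19 hT]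
  simp only [mem_graph_ofCLM_pcomp_iff, ContinuousLinearMap.adjoint_inner_right]
  exact ⟨fun h a b hab => h a _ ⟨b, hab, rfl⟩, by rintro h a _ ⟨b, hab, rfl⟩; exact h a b hab⟩

theorem ContinuousLinearMap.isQuasiAffinity_of_isSelfAdjoint {X : E →L[ℂ] E}
    (hX : IsSelfAdjoint X) (hinj : Function.Injective X) : IsQuasiAffinity X := by
  refine ⟨hinj, ?_⟩
  have h : Dense (X.range : Set E) := by
    rw [Submodule.dense_iff_topologicalClosure_eq_top, Submodule.topologicalClosure_eq_top_iff,
      ContinuousLinearMap.orthogonal_range, hX.adjoint_eq]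
    exact LinearMap.ker_eq_bot.2 hinj
  exact h

theorem ContinuousLinearMap.IsPositive.cfc_sqrt_comp_self {A : E →L[ℂ] E} (hA : A.IsPositive) :
    (cfc Real.sqrt A).comp (cfc Real.sqrt A) = A := by
  have h0 : 0 ≤ A := (ContinuousLinearMap.nonneg_iff_isPositive A).2 hA
  have hsa : IsSelfAdjoint A := hA.isSelfAdjoint
  change cfc Real.sqrt A * cfc Real.sqrt A = A
  rw [← cfc_mul Real.sqrt Real.sqrt A]
  conv_rhs => rw [← cfc_id' ℝ A]
  exact cfc_congr fun x hx => Real.mul_self_sqrt (spectrum_nonneg_of_nonneg h0 hx)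

end ClosedOperators

/-- if `T = A ∘ B ∈ L²₊` is closed with `A ∈ L⁺(H)` injective and `B` nonnegative
selfadjoint, then `A^{1/2}` is a quasi-affinity, `S = A^{1/2} ∘ B ∘ A^{1/2}` is nonnegative
selfadjoint, and `T*` is `A^{1/2}`-quasi-affine to `S`. -/
theorem statement19
    {H : Type*} [NormedAddCommGroup H] [InnerProductSpace ℂ H] [CompleteSpace H]
    (A : H →L[ℂ] H) (hA : A.IsPositive) (hAinj : Function.Injective A)
    (B : H →ₗ.[ℂ] H) (hB : IsNonnegSelfAdjoint B)
    (hT : (pcomp (ofCLM A) B).IsClosed)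
    (Ah : H →L[ℂ] H) (hAh : Ah = cfc Real.sqrt A)
    (S : H →ₗ.[ℂ] H) (hS : S = pcomp (pcomp (ofCLM Ah) B) (ofCLM Ah)) :
    IsQuasiAffinity Ah ∧
    IsNonnegSelfAdjoint S ∧
    ∀ y : (pcomp (ofCLM A) B).adjoint.domain,
      ∃ h : Ah (y : H) ∈ S.domain,
        S ⟨Ah (y : H), h⟩ = Ah ((pcomp (ofCLM A) B).adjoint y) := by
  have hsq : Ah.comp Ah = A := hAh ▸ hA.cfc_sqrt_comp_self
  have hsa : IsSelfAdjoint Ah := hAh ▸ cfc_predicate Real.sqrt A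
  have hinj : Function.Injective Ah := fun x y h => hAinj (by simp [← hsq, h])
  obtain ⟨hBd, hBs, hBp⟩ := hB
  have hDc : (pcomp (ofCLM Ah) B).IsClosed :=
    isClosed_ofCLM_pcomp_of_comp hinj (by rwa [hsq])
  have hDd : Dense ((pcomp (ofCLM Ah) B).domain : Set H) := by rwa [domain_ofCLM_pcomp]
  have hDa : (pcomp (ofCLM Ah) B).adjoint = pcomp B (ofCLM Ah) := by
    rw [adjoint_ofCLM_pcomp hBd, hBs, hsa.adjoint_eq]
  have hDad := hDc.dense_adjoint_domain hDd
  have hmem (x z : H) : (x, z) ∈ S.graph ↔ ∃ w, (Ah x, w) ∈ B.graph ∧ Ah w = z := by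
    rw [hS, mem_graph_pcomp_ofCLM_iff_s19, mem_graph_ofCLM_pcomp_iff]
  have hS' : S = pcomp (ofCLM Ah) (pcomp (ofCLM Ah) B).adjoint := by
    refine LinearPMap.eq_of_eq_graph ?_
    ext ⟨x, z⟩
    rw [hmem, mem_graph_ofCLM_pcomp_iff, hDa]
    simp only [mem_graph_pcomp_ofCLM_iff_s19]
  refine ⟨ContinuousLinearMap.isQuasiAffinity_of_isSelfAdjoint hsa hinj, ⟨?_, ?_, ?_⟩, ?_⟩
  · rwa [hS', domain_ofCLM_pcomp]
  · rw [hS', adjoint_ofCLM_pcomp hDad, hDc.adjoint_adjoint hDd, hsa.adjoint_eq, ← hS, hS']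
  · intro x
    obtain ⟨w, hw, hwx⟩ := (hmem x (S x)).1 (S.mem_graph x)
    obtain ⟨v, hv, rfl⟩ := (LinearPMap.mem_graph_iff B).1 hw
    rw [← hwx, ← ContinuousLinearMap.adjoint_inner_right, hsa.adjoint_eq]
    simpa [hv] using hBp v
  · intro y
    have hTa : (pcomp (ofCLM A) B).adjoint = pcomp B (ofCLM A) := by
      rw [adjoint_ofCLM_pcomp hBd, hBs, hA.isSelfAdjoint.adjoint_eq]
    have hy' : ((y : H), (pcomp (ofCLM A) B).adjoint y) ∈ (pcomp B (ofCLM A)).graph := by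
      rw [← hTa]
      exact LinearPMap.mem_graph _ y
    rw [mem_graph_pcomp_ofCLM_iff_s19] at hy'
    have hAy : Ah (Ah y) = A y := by rw [← ContinuousLinearMap.comp_apply, hsq]
    have hg : (Ah y, Ah ((pcomp (ofCLM A) B).adjoint y)) ∈ S.graph := by
      rw [hmem]
      exact ⟨_, by rwa [hAy], rfl⟩
    have hdom := LinearPMap.mem_domain_of_mem_graph hg
    exact ⟨hdom, ((LinearPMap.image_iff hdom).2 hg).symm⟩
end
end
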